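/- Let P ⊆ Σ^ω (Σ = 2^Ap) be a property such that P = L(φ) for some LTL formula φ. Then: P is a guarantee property iff P = L(ψ) for some ψ ∈ Σ₁; P is a safety property iff P = L(ψ) for some ψ ∈ Π₁; P is an obligation property iff P = L(ψ) for some ψ ∈ Δ₁; P is a persistence property iff P = L(ψ) for some ψ ∈ Σ₂; P is a recurrence property iff P = L(ψ) for some ψ ∈ Π₂; and P is a reactivity property iff P = L(ψ) for some ψ ∈ Δ₂. -/

import Mathlib

namespace LTLNorm

/-- LTL formulas in negation normal form. -/
inductive F (Ap : Type) : Type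
  | tt    : F Ap
  | ff    : F Ap
  | pos   : Ap → F Ap
  | nlit  : Ap → F Ap
  | and   : F Ap → F Ap → F Ap
  | or    : F Ap → F Ap → F Ap
  | next  : F Ap → F Ap
  | untl  : F Ap → F Ap → F Ap
  | wuntl : F Ap → F Ap → F Ap
  | rel   : F Ap → F Ap → F Ap
  | srel  : F Ap → F Ap → F Ap
  deriving DecidableEq

/-- Infinite words over the alphabet `2^Ap`. -/
abbrev Word (Ap : Type) := ℕ → Set Ap

/-- Suffix of a word starting at position `i`. -/
def suff {Ap : Type} (w : Word Ap) (i : ℕ) : Word Ap := fun n => w (n + i)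

/-- Satisfaction relation. -/
def Sat {Ap : Type} : Word Ap → F Ap → Prop
  | _, F.tt => True
  | _, F.ff => False
  | w, F.pos a => a ∈ w 0
  | w, F.nlit a => a ∉ w 0
  | w, F.and φ ψ => Sat w φ ∧ Sat w ψ
  | w, F.or φ ψ => Sat w φ ∨ Sat w ψ
  | w, F.next φ => Sat (suff w 1) φ
  | w, F.untl φ ψ => ∃ k, Sat (suff w k) ψ ∧ ∀ j < k, Sat (suff w j) φ
  | w, F.wuntl φ ψ => (∀ k, Sat (suff w k) φ) ∨ ∃ k, Sat (suff w k) ψ ∧ ∀ j < k, Sat (suff w j) φ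
  | w, F.srel φ ψ => ∃ k, Sat (suff w k) φ ∧ ∀ j ≤ k, Sat (suff w j) ψ
  | w, F.rel φ ψ => (∀ k, Sat (suff w k) ψ) ∨ ∃ k, Sat (suff w k) φ ∧ ∀ j ≤ k, Sat (suff w j) ψ

/-- Equivalence of formulas. -/
def Equiv {Ap : Type} (φ ψ : F Ap) : Prop := ∀ w : Word Ap, Sat w φ ↔ Sat w ψ

/-- Entailment: every word satisfying `φ` satisfies `ψ`. -/
def Entails {Ap : Type} (φ ψ : F Ap) : Prop := ∀ w : Word Ap, Sat w φ → Sat w ψ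

/-- F φ := tt U φ -/
def Ff {Ap : Type} (φ : F Ap) : F Ap := F.untl F.tt φ
/-- G φ := φ W ff -/
def Gf {Ap : Type} (φ : F Ap) : F Ap := F.wuntl φ F.ff
/-- GF φ := G (F φ) -/
def GFf {Ap : Type} (φ : F Ap) : F Ap := Gf (Ff φ)
/-- FG φ := F (G φ) -/
def FGf {Ap : Type} (φ : F Ap) : F Ap := Ff (Gf φ)

/-- Number of nodes of the syntax tree. -/
def size {Ap : Type} : F Ap → ℕ
  | F.tt => 1
  | F.ff => 1
  | F.pos _ => 1
  | F.nlit _ => 1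
  | F.and φ ψ => size φ + size ψ + 1
  | F.or φ ψ => size φ + size ψ + 1
  | F.next φ => size φ + 1
  | F.untl φ ψ => size φ + size ψ + 1
  | F.wuntl φ ψ => size φ + size ψ + 1
  | F.rel φ ψ => size φ + size ψ + 1
  | F.srel φ ψ => size φ + size ψ + 1

/-- The dual of a formula in negation normal form. -/
def dual {Ap : Type} : F Ap → F Ap
  | F.tt => F.ff
  | F.ff => F.tt
  | F.pos a => F.nlit a
  | F.nlit a => F.pos a
  | F.and φ ψ => F.or (dual φ) (dual ψ)
  | F.or φ ψ => F.and (dual φ) (dual ψ)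
  | F.next φ => F.next (dual φ)
  | F.untl φ ψ => F.rel (dual φ) (dual ψ)
  | F.rel φ ψ => F.untl (dual φ) (dual ψ)
  | F.wuntl φ ψ => F.srel (dual φ) (dual ψ)
  | F.srel φ ψ => F.wuntl (dual φ) (dual ψ)

mutual
/-- The class Σ_i of the syntactic future hierarchy. -/
inductive SigmaC (Ap : Type) : ℕ → F Ap → Prop where
  | tt (i : ℕ) : SigmaC Ap i F.tt
  | ff (i : ℕ) : SigmaC Ap i F.ff
  | pos (i : ℕ) (a : Ap) : SigmaC Ap i (F.pos a)
  | nlit (i : ℕ) (a : Ap) : SigmaC Ap i (F.nlit a)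
  | and {i : ℕ} {φ ψ : F Ap} : SigmaC Ap i φ → SigmaC Ap i ψ → SigmaC Ap i (F.and φ ψ)
  | or {i : ℕ} {φ ψ : F Ap} : SigmaC Ap i φ → SigmaC Ap i ψ → SigmaC Ap i (F.or φ ψ)
  | ofPi {i : ℕ} {φ : F Ap} : PiC Ap i φ → SigmaC Ap (i + 1) φ
  | next {i : ℕ} {φ : F Ap} : SigmaC Ap (i + 1) φ → SigmaC Ap (i + 1) (F.next φ)
  | untl {i : ℕ} {φ ψ : F Ap} :
      SigmaC Ap (i + 1) φ → SigmaC Ap (i + 1) ψ → SigmaC Ap (i + 1) (F.untl φ ψ)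
  | srel {i : ℕ} {φ ψ : F Ap} :
      SigmaC Ap (i + 1) φ → SigmaC Ap (i + 1) ψ → SigmaC Ap (i + 1) (F.srel φ ψ)

/-- The class Π_i of the syntactic future hierarchy. -/
inductive PiC (Ap : Type) : ℕ → F Ap → Prop where
  | tt (i : ℕ) : PiC Ap i F.tt
  | ff (i : ℕ) : PiC Ap i F.ff
  | pos (i : ℕ) (a : Ap) : PiC Ap i (F.pos a)
  | nlit (i : ℕ) (a : Ap) : PiC Ap i (F.nlit a)
  | and {i : ℕ} {φ ψ : F Ap} : PiC Ap i φ → PiC Ap i ψ → PiC Ap i (F.and φ ψ)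
  | or {i : ℕ} {φ ψ : F Ap} : PiC Ap i φ → PiC Ap i ψ → PiC Ap i (F.or φ ψ)
  | ofSigma {i : ℕ} {φ : F Ap} : SigmaC Ap i φ → PiC Ap (i + 1) φ
  | next {i : ℕ} {φ : F Ap} : PiC Ap (i + 1) φ → PiC Ap (i + 1) (F.next φ)
  | rel {i : ℕ} {φ ψ : F Ap} :
      PiC Ap (i + 1) φ → PiC Ap (i + 1) ψ → PiC Ap (i + 1) (F.rel φ ψ)
  | wuntl {i : ℕ} {φ ψ : F Ap} :
      PiC Ap (i + 1) φ → PiC Ap (i + 1) ψ → PiC Ap (i + 1) (F.wuntl φ ψ)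
end

/-- The class Δ_i of the syntactic future hierarchy. -/
inductive DeltaC (Ap : Type) : ℕ → F Ap → Prop where
  | ofSigma {i : ℕ} {φ : F Ap} : SigmaC Ap i φ → DeltaC Ap i φ
  | ofPi {i : ℕ} {φ : F Ap} : PiC Ap i φ → DeltaC Ap i φ
  | and {i : ℕ} {φ ψ : F Ap} : DeltaC Ap i φ → DeltaC Ap i ψ → DeltaC Ap i (F.and φ ψ)
  | or {i : ℕ} {φ ψ : F Ap} : DeltaC Ap i φ → DeltaC Ap i ψ → DeltaC Ap i (F.or φ ψ)

/-- The language of a formula. -/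
def Lang {Ap : Type} (φ : F Ap) : Set (Word Ap) := {w | Sat w φ}

/-- The finite prefix of length `n` of an infinite word. -/
def pre {Ap : Type} (w : Word Ap) (n : ℕ) : List (Set Ap) := (List.range n).map w

/-- Safety properties. -/
def SafetyP {Ap : Type} (P : Set (Word Ap)) : Prop :=
  ∃ L : Set (List (Set Ap)), ∀ w : Word Ap, w ∈ P ↔ ∀ n : ℕ, pre w n ∈ L

/-- Guarantee properties. -/
def GuaranteeP {Ap : Type} (P : Set (Word Ap)) : Prop :=
  ∃ L : Set (List (Set Ap)), ∀ w : Word Ap, w ∈ P ↔ ∃ n : ℕ, pre w n ∈ L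

/-- Recurrence properties. -/
def RecurrenceP {Ap : Type} (P : Set (Word Ap)) : Prop :=
  ∃ L : Set (List (Set Ap)), ∀ w : Word Ap, w ∈ P ↔ {n : ℕ | pre w n ∈ L}.Infinite

/-- Persistence properties. -/
def PersistenceP {Ap : Type} (P : Set (Word Ap)) : Prop :=
  ∃ L : Set (List (Set Ap)), ∀ w : Word Ap, w ∈ P ↔ ∃ m : ℕ, ∀ n ≥ m, pre w n ∈ L

/-- Positive Boolean combinations (finite intersections and unions) of
properties in a base class. -/
inductive PosBool (Ap : Type) (base : Set (Word Ap) → Prop) : Set (Word Ap) → Prop where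
  | base {P : Set (Word Ap)} : base P → PosBool Ap base P
  | inter {P Q : Set (Word Ap)} : PosBool Ap base P → PosBool Ap base Q → PosBool Ap base (P ∩ Q)
  | union {P Q : Set (Word Ap)} : PosBool Ap base P → PosBool Ap base Q → PosBool Ap base (P ∪ Q)

/-- Obligation properties. -/
def ObligationP {Ap : Type} (P : Set (Word Ap)) : Prop :=
  PosBool Ap (fun Q => SafetyP Q ∨ GuaranteeP Q) P

/-- Reactivity properties. -/
def ReactivityP {Ap : Type} (P : Set (Word Ap)) : Prop :=
  PosBool Ap (fun Q => RecurrenceP Q ∨ PersistenceP Q) P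

/-! ### Labelled transition systems and local divisors -/

/-- `Run step h B s x y`: there is a path from `x` to `y` with labels in `B` whose `h`-value is `s`. -/
inductive Run {X A M : Type} [Monoid M] (step : A → X → X → Prop) (h : A → M) (B : Set A) :
    M → X → X → Prop
  | nil (x : X) : Run step h B 1 x x
  | cons {a : A} {s : M} {x y z : X} : a ∈ B → step a x y → Run step h B s y z →
      Run step h B (h a * s) x z

/-- States from which some path through `P` reaches `Q`. -/
inductive Unt {X A : Type} (step : A → X → X → Prop) (P Q : Set X) : X → Prop
  | base {x : X} : x ∈ Q → Unt step P Q x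
  | move {a : A} {x y : X} : x ∈ P → step a x y → Unt step P Q y → Unt step P Q x

/-- A bounded lattice of sets of states closed under predecessors and `Unt`. -/
structure ClosedFamily {X A : Type} (step : A → X → X → Prop) (C : Set (Set X)) : Prop where
  empty : ∅ ∈ C
  univ : Set.univ ∈ C
  union : ∀ {P Q : Set X}, P ∈ C → Q ∈ C → P ∪ Q ∈ C
  inter : ∀ {P Q : Set X}, P ∈ C → Q ∈ C → P ∩ Q ∈ C
  pred : ∀ (a : A) {Q : Set X}, Q ∈ C → {x | ∃ y, step a x y ∧ y ∈ Q} ∈ C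
  unt : ∀ {P Q : Set X}, P ∈ C → Q ∈ C → {x | Unt step P Q x} ∈ C

/-- Determinism of a labelled transition system. -/
def Determ {X A : Type} (step : A → X → X → Prop) : Prop :=
  ∀ ⦃a b x y z⦄, step a x y → step b x z → a = b ∧ y = z

/-- All powers of every element stabilise. -/
def Aperiodic (M : Type) [Monoid M] : Prop := ∀ x : M, ∃ n : ℕ, x ^ (n + 1) = x ^ n

theorem biUnion_mem_of_finite {X ι : Type} {C : Set (Set X)} (h0 : ∅ ∈ C)
    (hU : ∀ {P Q : Set X}, P ∈ C → Q ∈ C → P ∪ Q ∈ C) {s : Set ι} (hs : s.Finite)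
    (f : ι → Set X) (hf : ∀ i ∈ s, f i ∈ C) : (⋃ i ∈ s, f i) ∈ C := by
  induction s, hs using Set.Finite.induction_on with
  | empty => simpa using h0
  | @insert a s _ _ ih =>
    rw [Set.biUnion_insert]
    exact hU (hf a (Set.mem_insert _ _)) (ih fun i hi => hf i (Set.mem_insert_of_mem _ hi))

theorem biInter_mem_of_finite {X ι : Type} {C : Set (Set X)} (h0 : Set.univ ∈ C)
    (hI : ∀ {P Q : Set X}, P ∈ C → Q ∈ C → P ∩ Q ∈ C) {s : Set ι} (hs : s.Finite)
    (f : ι → Set X) (hf : ∀ i ∈ s, f i ∈ C) : (⋂ i ∈ s, f i) ∈ C := by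
  induction s, hs using Set.Finite.induction_on with
  | empty => simpa using h0
  | @insert a s _ _ ih =>
    rw [Set.biInter_insert]
    exact hI (hf a (Set.mem_insert _ _)) (ih fun i hi => hf i (Set.mem_insert_of_mem _ hi))

/-- The local divisor of `M` at `c`, with underlying set `cM ∩ Mc`. -/
def LocalDivisor {M : Type} [Monoid M] (c : M) : Type :=
  {x : M // (∃ y, x = c * y) ∧ ∃ z, x = z * c}

namespace LocalDivisor

variable {M : Type} [Monoid M] {c : M}

/-- The element `c * t * c` of the local divisor. -/
def sandwich (c t : M) : LocalDivisor c :=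
  ⟨c * t * c, ⟨t * c, by rw [mul_assoc]⟩, ⟨c * t, rfl⟩⟩

/-- A left cofactor of an element of the local divisor. -/
noncomputable def cof (x : LocalDivisor c) : M := x.2.2.choose

theorem cof_mul (x : LocalDivisor c) : x.cof * c = x.1 := x.2.2.choose_spec.symm

noncomputable instance : Mul (LocalDivisor c) where
  mul x y := ⟨x.cof * y.1, by
      obtain ⟨u, hu⟩ := y.2.1
      obtain ⟨v, hv⟩ := x.2.1
      exact ⟨v * u, by rw [hu, ← mul_assoc, cof_mul, hv, mul_assoc]⟩, by
      obtain ⟨z, hz⟩ := y.2.2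
      exact ⟨x.cof * z, by rw [hz, mul_assoc]⟩⟩

instance : One (LocalDivisor c) where
  one := ⟨c, ⟨1, by simp⟩, ⟨1, by simp⟩⟩

theorem coe_mul (x y : LocalDivisor c) : (x * y).1 = x.cof * y.1 := rfl

theorem coe_one : (1 : LocalDivisor c).1 = c := rfl

theorem coe_mul_of_eq {x y : LocalDivisor c} {u : M} (h : x.1 = u * c) : (x * y).1 = u * y.1 := by
  obtain ⟨v, hv⟩ := y.2.1
  rw [coe_mul, hv, ← mul_assoc, cof_mul, h, mul_assoc]

theorem sandwich_mul (t : M) (y : LocalDivisor c) : (sandwich c t * y).1 = c * t * y.1 :=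
  coe_mul_of_eq rfl

noncomputable instance : Monoid (LocalDivisor c) where
  mul_assoc x y z := by
    apply Subtype.ext
    have h : (x * y).1 = (x.cof * y.cof) * c := by rw [coe_mul, mul_assoc, cof_mul]
    rw [coe_mul_of_eq h, coe_mul, coe_mul, mul_assoc]
  one_mul x := by
    apply Subtype.ext
    rw [coe_mul_of_eq (u := 1) (by rw [coe_one, one_mul]), one_mul]
  mul_one x := by
    apply Subtype.ext
    rw [coe_mul, coe_one, cof_mul]

theorem coe_pow (x : LocalDivisor c) (n : ℕ) : (x ^ n).1 = x.cof ^ n * c := by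
  induction n with
  | zero => rw [pow_zero, pow_zero, one_mul, coe_one]
  | succ n ih => rw [pow_succ', coe_mul, ih, pow_succ', mul_assoc]

theorem aperiodic (hM : Aperiodic M) : Aperiodic (LocalDivisor c) := fun x => by
  obtain ⟨n, hn⟩ := hM x.cof
  exact ⟨n, Subtype.ext (by rw [coe_pow, coe_pow, hn])⟩

instance [Finite M] : Finite (LocalDivisor c) := Subtype.finite

theorem card_lt [Finite M] (hM : Aperiodic M) (hc : c ≠ 1) :
    Nat.card (LocalDivisor c) < Nat.card M := by
  refine Finite.card_subtype_lt (x := 1) fun h => hc ?_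
  obtain ⟨⟨y, hy⟩, -⟩ := h
  obtain ⟨n, hn⟩ := hM c
  have hpow : ∀ k : ℕ, c ^ k * y ^ k = 1 := fun k => by
    induction k with
    | zero => simp
    | succ k ih => rw [pow_succ, pow_succ', mul_assoc, ← mul_assoc c, ← hy, one_mul, ih]
  calc c = c * (c ^ n * y ^ n) := by rw [hpow, mul_one]
    _ = 1 := by rw [← mul_assoc, ← pow_succ', hn, hpow]

end LocalDivisor

section Reach

variable {X A M : Type} [Monoid M] {step : A → X → X → Prop} {h : A → M}

theorem Run.mono {B B' : Set A} (hB : B ⊆ B') {s : M} {x y : X} (r : Run step h B s x y) :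
    Run step h B' s x y := by
  induction r with
  | nil x => exact .nil x
  | cons ha hs _ ih => exact .cons (hB ha) hs ih

theorem Run.trans {B : Set A} {s t : M} {x y z : X} (r : Run step h B s x y)
    (r' : Run step h B t y z) : Run step h B (s * t) x z := by
  induction r with
  | nil x => simpa using r'
  | cons ha hs _ ih => rw [mul_assoc]; exact .cons ha hs (ih r')

theorem Run.unt {B : Set A} {P Q : Set X} (hP : ∀ b ∈ B, ∀ x y, step b x y → x ∈ P)
    {s : M} {x y : X} (r : Run step h B s x y) (hy : Unt step P Q y) : Unt step P Q x := by
  induction r with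
  | nil x => exact hy
  | cons ha hs _ ih => exact .move (hP _ ha _ _ hs) hs (ih hy)

/-- The compound transition: a run in `B` followed by one `c`-transition. -/
def blockStep (step : A → X → X → Prop) (h : A → M) (B : Set A) (c : A) (t : M) (x y : X) : Prop :=
  ∃ z, Run step h B t x z ∧ step c z y

theorem determ_blockStep (hd : Determ step) {B : Set A} {c : A} (hc : c ∉ B) :
    Determ (blockStep step h B c) := by
  rintro s t x y z ⟨u, r, hu⟩ ⟨v, r', hv⟩
  induction r generalizing t with
  | nil x =>
    cases r' with
    | nil => exact ⟨rfl, (hd hu hv).2⟩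
    | cons hb hs _ => exact absurd ((hd hu hs).1 ▸ hb) hc
  | cons ha hs _ ih =>
    cases r' with
    | nil => exact absurd ((hd hv hs).1 ▸ ha) hc
    | cons hb hs' r' =>
      obtain ⟨rfl, rfl⟩ := hd hs hs'
      obtain ⟨rfl, rfl⟩ := ih hu r'
      exact ⟨rfl, rfl⟩

theorem unt_blockStep (hd : Determ step) {B : Set A} {c : A} {P Q : Set X} :
    {x | Unt (blockStep step h B c) P Q x} =
      Q ∪ (P ∩ {x | Unt step ((⋃ b ∈ B, {x | ∃ y, step b x y ∧ y ∈ Set.univ}) ∪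
        {x | ∃ y, step c x y ∧ y ∈ P}) {x | ∃ y, step c x y ∧ y ∈ Q} x}) := by
  set R := (⋃ b ∈ B, {x | ∃ y, step b x y ∧ y ∈ Set.univ}) ∪ {x | ∃ y, step c x y ∧ y ∈ P}
  set Q' := {x | ∃ y, step c x y ∧ y ∈ Q}
  have hB : ∀ b ∈ B, ∀ x y, step b x y → x ∈ R := fun b hb x y hs =>
    Or.inl (Set.mem_biUnion hb ⟨y, hs, trivial⟩)
  ext x
  constructor
  · intro hx
    induction hx with
    | base hx => exact Or.inl hx
    | @move a x y hx hs _ ih =>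
      obtain ⟨z, r, hz⟩ := hs
      refine Or.inr ⟨hx, r.unt hB ?_⟩
      rcases ih with hy | ⟨hy, hu⟩
      · exact .base ⟨y, hz, hy⟩
      · exact .move (Or.inr ⟨y, hz, hy⟩) hz hu
  · rintro (hx | ⟨hx, hu⟩)
    · exact .base hx
    · have key : ∀ x, Unt step R Q' x →
          ∃ t y, blockStep step h B c t x y ∧ Unt (blockStep step h B c) P Q y := by
        intro x hu
        induction hu with
        | @base x hx =>
          obtain ⟨y, hs, hy⟩ := hx
          exact ⟨1, y, ⟨x, .nil x, hs⟩, .base hy⟩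
        | @move a x y hx hs _ ih =>
          obtain ⟨t, y', ⟨z, r, hz⟩, hy'⟩ := ih
          rcases hx with hx | ⟨y₀, hs₀, hy₀⟩
          · obtain ⟨b, hb, y₀, hs₀, -⟩ := Set.mem_iUnion₂.1 hx
            obtain ⟨rfl, rfl⟩ := hd hs hs₀
            exact ⟨h a * t, y', ⟨z, .cons hb hs r, hz⟩, hy'⟩
          · obtain ⟨rfl, rfl⟩ := hd hs hs₀
            exact ⟨1, y, ⟨x, .nil x, hs⟩, .move hy₀ ⟨z, r, hz⟩ hy'⟩
      obtain ⟨t, y, hs, hy⟩ := key x hu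
      exact .move hx hs hy

theorem run_insert_iff {B : Set A} {c : A} {s : M} {x y : X} :
    Run step h (insert c B) s x y ↔ Run step h B s x y ∨
      ∃ (p : M × LocalDivisor (h c) × M), p.1 * p.2.1.1 * p.2.2 = s ∧
        ∃ x₁, Run step h B p.1 x x₁ ∧ ∃ x₂, step c x₁ x₂ ∧
        ∃ x₃, Run (blockStep step h B c) (LocalDivisor.sandwich (h c)) Set.univ p.2.1 x₂ x₃ ∧
          Run step h B p.2.2 x₃ y := by
  constructor
  · intro r
    induction r with
    | nil x => exact Or.inl (.nil x)
    | @cons a s x y z ha hs _ ih =>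
      rcases ha with rfl | ha
      · rcases ih with r | ⟨⟨s₀, t, s₁⟩, rfl, x₁, r₁, x₂, hc, x₃, r₂, r₃⟩
        · exact Or.inr ⟨(1, 1, s), by simp [LocalDivisor.coe_one], x, .nil x, y, hs, y, .nil y, r⟩
        · refine Or.inr ⟨(1, LocalDivisor.sandwich (h a) s₀ * t, s₁), ?_, x, .nil x, y, hs, x₃,
            .cons trivial ⟨x₁, r₁, hc⟩ r₂, r₃⟩
          simp only [LocalDivisor.sandwich_mul, one_mul, mul_assoc]
      · rcases ih with r | ⟨⟨s₀, t, s₁⟩, rfl, x₁, r₁, x₂, hc, x₃, r₂, r₃⟩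
        · exact Or.inl (.cons ha hs r)
        · exact Or.inr ⟨(h a * s₀, t, s₁), by simp only [mul_assoc], x₁, .cons ha hs r₁, x₂, hc,
            x₃, r₂, r₃⟩
  · have hB : B ⊆ insert c B := Set.subset_insert c B
    rintro (r | ⟨⟨s₀, t, s₁⟩, rfl, x₁, r₁, x₂, hc, x₃, r₂, r₃⟩)
    · exact r.mono hB
    · have key : Run step h (insert c B) t.1 x₁ x₃ := by
        simp only at r₂ ⊢
        clear r₁ r₃
        induction r₂ generalizing x₁ with
        | nil x =>
          have := Run.cons (h := h) (Set.mem_insert c B) hc (Run.nil x)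
          simpa [LocalDivisor.coe_one] using this
        | cons _ hs _ ih =>
          obtain ⟨z, r, hz⟩ := hs
          have := Run.cons (h := h) (Set.mem_insert c B) hc ((r.mono hB).trans (ih z hz))
          rwa [← mul_assoc, ← LocalDivisor.sandwich_mul] at this
      exact ((r₁.mono hB).trans key).trans (r₃.mono hB)

theorem run_trivial_iff {B : Set A} (hd : Determ step) (hB : ∀ b ∈ B, h b = 1) {s : M} {x : X}
    {Q : Set X} : (∃ y, Run step h B s x y ∧ y ∈ Q) ↔
      s = 1 ∧ Unt step (⋃ b ∈ B, {x | ∃ y, step b x y ∧ y ∈ Set.univ}) Q x := by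
  constructor
  · rintro ⟨y, r, hy⟩
    have hP : ∀ b ∈ B, ∀ x y, step b x y →
        x ∈ ⋃ b ∈ B, {x | ∃ y, step b x y ∧ y ∈ Set.univ} := fun b hb x y hs =>
      Set.mem_biUnion hb ⟨y, hs, trivial⟩
    refine ⟨?_, r.unt hP (.base hy)⟩
    clear hy
    induction r with
    | nil => rfl
    | cons ha _ _ ih => rw [hB _ ha, ih, one_mul]
  · rintro ⟨rfl, hu⟩
    induction hu with
    | @base x hx => exact ⟨x, .nil x, hx⟩
    | @move a x y hx hs _ ih =>
      obtain ⟨b, hb, y₀, hs₀, -⟩ := Set.mem_iUnion₂.1 hx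
      obtain ⟨rfl, rfl⟩ := hd hs hs₀
      obtain ⟨z, r, hz⟩ := ih
      have := Run.cons hb hs r
      rw [hB _ hb, one_mul] at this
      exact ⟨z, this, hz⟩

end Reach

/-- Closed families are closed under concatenation with languages recognised by finite aperiodic
monoids. -/
theorem ClosedFamily.run_mem {X : Type} {C : Set (Set X)} (n : ℕ) :
    ∀ {M A : Type} [Monoid M] [Finite M], Nat.card M ≤ n → Aperiodic M →
    ∀ {step : A → X → X → Prop}, Determ step → ClosedFamily step C →
    ∀ (h : A → M) {B : Set A}, B.Finite → ∀ (s : M) {Q : Set X}, Q ∈ C →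
      {x | ∃ y, Run step h B s x y ∧ y ∈ Q} ∈ C := by
  induction n with
  | zero =>
    intro M A _ _ hM
    exact absurd (Nat.card_pos (α := M)) (by omega)
  | succ n ihn =>
    intro M A _ _ hM hA step hd hC h B hB
    induction hk : B.ncard generalizing B with
    | zero =>
      rw [Set.ncard_eq_zero hB] at hk
      subst hk
      intro s Q hQ
      simp only [run_trivial_iff (B := ∅) hd (by simp)]
      by_cases hs : s = 1
      · simpa [hs] using hC.unt hC.empty hQ
      · simpa [hs] using hC.empty
    | succ k ihk =>
      intro s Q hQ
      by_cases hone : ∀ b ∈ B, h b = 1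
      · simp only [run_trivial_iff hd hone]
        by_cases hs : s = 1
        · simpa only [hs, true_and] using hC.unt
            (biUnion_mem_of_finite hC.empty hC.union hB _ fun b _ => hC.pred b hC.univ) hQ
        · simpa [hs] using hC.empty
      · push Not at hone
        obtain ⟨c, hcB, hc⟩ := hone
        have hfin : (B \ {c}).Finite := hB.sdiff
        have hcard : (B \ {c}).ncard = k := by
          rw [Set.ncard_sdiff_singleton_of_mem hcB, hk]; rfl
        have ihB := @ihk (B \ {c}) hfin hcard
        have hins : B = insert c (B \ {c}) := by simp [Set.insert_eq_of_mem hcB]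
        have hcB' : c ∉ B \ {c} := by simp
        generalize B \ {c} = B' at *
        subst hins
        have hC' : ClosedFamily (blockStep step h B' c) C :=
          { empty := hC.empty
            univ := hC.univ
            union := hC.union
            inter := hC.inter
            pred := fun t Q hQ => by
              convert ihB t (hC.pred c hQ) using 1
              ext x
              constructor
              · rintro ⟨y, ⟨z, r, hz⟩, hy⟩
                exact ⟨z, r, y, hz, hy⟩
              · rintro ⟨z, r, y, hz, hy⟩
                exact ⟨y, ⟨z, r, hz⟩, hy⟩
            unt := fun {P Q} hP hQ => by
              rw [unt_blockStep hd]
              exact hC.union hQ (hC.inter hP (hC.unt (hC.union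
                (biUnion_mem_of_finite hC.empty hC.union hfin _ fun b _ => hC.pred b hC.univ)
                (hC.pred c hP)) (hC.pred c hQ))) }
        have ihT := fun (t : LocalDivisor (h c)) {Q : Set X} (hQ : Q ∈ C) =>
          ihn (Nat.lt_succ_iff.1 ((LocalDivisor.card_lt hA hc).trans_le hM))
            (LocalDivisor.aperiodic hA) (determ_blockStep hd hcB') hC'
            (LocalDivisor.sandwich (h c)) Set.finite_univ t hQ
        have hfinal := hC.union (ihB s hQ) (biUnion_mem_of_finite hC.empty hC.union
          (Set.toFinite {p : M × LocalDivisor (h c) × M | p.1 * p.2.1.1 * p.2.2 = s}) _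
          fun p _ => ihB p.1 (hC.pred c (ihT p.2.1 (ihB p.2.2 hQ))))
        convert hfinal using 1
        ext x
        simp only [run_insert_iff, Set.mem_union, Set.mem_iUnion, Set.mem_ofPred_eq, exists_prop]
        constructor
        · rintro ⟨y, r | ⟨p, hp, x₁, r₁, x₂, hx, x₃, r₂, r₃⟩, hy⟩
          · exact Or.inl ⟨y, r, hy⟩
          · exact Or.inr ⟨p, hp, x₁, r₁, x₂, hx, x₃, r₂, y, r₃, hy⟩
        · rintro (⟨y, r, hy⟩ | ⟨p, hp, x₁, r₁, x₂, hx, x₃, r₂, y, r₃, hy⟩)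
          · exact ⟨y, Or.inl r, hy⟩
          · exact ⟨y, Or.inr ⟨p, hp, x₁, r₁, x₂, hx, x₃, r₂, r₃⟩, hy⟩

/-! ### Duality of the temporal operators -/

theorem until_compl_iff (p q : ℕ → Prop) :
    (¬ ∃ k, ¬ q k ∧ ∀ j < k, ¬ p j) ↔ (∀ k, q k) ∨ ∃ k, p k ∧ ∀ j ≤ k, q j := by
  constructor
  · intro h
    by_cases hq : ∀ k, q k
    · exact Or.inl hq
    · classical
      push Not at hq h
      have hp : ∃ k, p k := by
        obtain ⟨k, hk⟩ := hq
        obtain ⟨j, -, hj⟩ := h k hk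
        exact ⟨j, hj⟩
      refine Or.inr ⟨Nat.find hp, Nat.find_spec hp, fun j hj => ?_⟩
      by_contra hqj
      obtain ⟨i, hi, hpi⟩ := h j hqj
      exact Nat.find_min hp (hi.trans_le hj) hpi
  · rintro (h | ⟨k, hk, hq⟩) ⟨m, hm, hp⟩
    · exact hm (h m)
    · rcases lt_or_ge k m with hkm | hkm
      · exact hp k hkm hk
      · exact hm (hq m hkm)

theorem sat_srel_iff {Ap : Type} (w : Word Ap) (φ ψ : F Ap) : Sat w (F.srel φ ψ) ↔
    ∃ k, (Sat (suff w k) φ ∧ Sat (suff w k) ψ) ∧ ∀ j < k, Sat (suff w j) ψ := by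
  refine exists_congr fun k => ⟨fun ⟨h, h'⟩ => ⟨⟨h, h' k le_rfl⟩, fun j hj => h' j hj.le⟩,
    fun ⟨⟨h, h₂⟩, h'⟩ => ⟨h, fun j hj => ?_⟩⟩
  rcases hj.lt_or_eq with hj | rfl
  · exact h' j hj
  · exact h₂

theorem sat_rel_iff {Ap : Type} (w : Word Ap) (φ ψ : F Ap) : Sat w (F.rel φ ψ) ↔
    ¬ ∃ k, ¬ Sat (suff w k) ψ ∧ ∀ j < k, ¬ Sat (suff w j) φ :=
  (until_compl_iff (fun k => Sat (suff w k) φ) fun k => Sat (suff w k) ψ).symm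

theorem sat_wuntl_iff {Ap : Type} (w : Word Ap) (φ ψ : F Ap) : Sat w (F.wuntl φ ψ) ↔
    ¬ ∃ k, (¬ Sat (suff w k) φ ∧ ¬ Sat (suff w k) ψ) ∧ ∀ j < k, ¬ Sat (suff w j) ψ := by
  simp only [← not_or]
  rw [until_compl_iff (fun k => Sat (suff w k) ψ)
    fun k => Sat (suff w k) φ ∨ Sat (suff w k) ψ]
  constructor
  · rintro (h | ⟨k, hk, h⟩)
    · exact Or.inl fun k => Or.inl (h k)
    · refine Or.inr ⟨k, hk, fun j hj => ?_⟩
      rcases hj.lt_or_eq with hj | rfl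
      · exact Or.inl (h j hj)
      · exact Or.inr hk
  · classical
    intro h
    by_cases hψ : ∃ k, Sat (suff w k) ψ
    · refine Or.inr ⟨Nat.find hψ, Nat.find_spec hψ, fun j hj => ?_⟩
      have hj' := Nat.find_min hψ hj
      rcases h with h | ⟨k, hk, h⟩
      · exact (h j).resolve_right hj'
      · exact (h j (hj.le.trans (Nat.find_min' hψ hk))).resolve_right hj'
    · push Not at hψ
      rcases h with h | ⟨k, hk, -⟩
      · exact Or.inl fun k => (h k).resolve_right (hψ k)
      · exact absurd hk (hψ k)

/-! ### Recognition of LTL languages by finite aperiodic monoids -/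

section Words

variable {Ap : Type}

@[simp] theorem suff_zero (w : Word Ap) : suff w 0 = w := rfl

theorem suff_suff (w : Word Ap) (m n : ℕ) : suff (suff w m) n = suff w (m + n) := by
  funext i
  simp only [suff]
  congr 1
  omega

theorem suff_apply (w : Word Ap) (m n : ℕ) : suff w m n = w (n + m) := rfl

/-- The value in `M` of the factor of length `n` at the start of `w`. -/
def val {M : Type} [Monoid M] (h : Set Ap → M) (w : Word Ap) : ℕ → M
  | 0 => 1
  | n + 1 => val h w n * h (w n)

variable {M : Type} [Monoid M] {h : Set Ap → M}

@[simp] theorem val_zero (w : Word Ap) : val h w 0 = 1 := rfl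

theorem val_succ (w : Word Ap) (n : ℕ) : val h w (n + 1) = val h w n * h (w n) := rfl

theorem val_add (w : Word Ap) (m n : ℕ) : val h w (m + n) = val h w m * val h (suff w m) n := by
  induction n with
  | zero => simp
  | succ n ih => rw [← add_assoc, val_succ, ih, val_succ, mul_assoc, suff_apply, add_comm n]

theorem val_succ' (w : Word Ap) (n : ℕ) : val h w (n + 1) = h (w 0) * val h (suff w 1) n := by
  rw [add_comm, val_add, val_succ, val_zero, one_mul]

theorem val_of_le (w : Word Ap) {m n : ℕ} (hmn : m ≤ n) :
    val h w n = val h w m * val h (suff w m) (n - m) := by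
  rw [← val_add, Nat.add_sub_cancel' hmn]

theorem val_congr {w w' : Word Ap} {n : ℕ} (hw : ∀ j < n, w j = w' j) :
    val h w n = val h w' n := by
  induction n with
  | zero => rfl
  | succ n ih =>
    rw [val_succ, val_succ, ih fun j hj => hw j (hj.trans n.lt_succ_self), hw n n.lt_succ_self]

/-- The word with the first `n` letters of `x` followed by `v`. -/
def splice (x : Word Ap) (n : ℕ) (v : Word Ap) : Word Ap :=
  fun j => if j < n then x j else v (j - n)

theorem splice_of_lt (x v : Word Ap) {n j : ℕ} (hj : j < n) : splice x n v j = x j := if_pos hj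

theorem suff_splice (x v : Word Ap) (n : ℕ) : suff (splice x n v) n = v := by
  funext j
  simp [suff, splice]

theorem suff_splice_add (x v : Word Ap) (n m : ℕ) : suff (splice x n v) (n + m) = suff v m := by
  rw [← suff_suff, suff_splice]

theorem splice_suff (w : Word Ap) (n : ℕ) : splice w n (suff w n) = w := by
  funext j
  by_cases hj : j < n
  · rw [splice_of_lt _ _ hj]
  · simp only [splice, if_neg hj, suff]
    congr 1
    omega

theorem val_splice (x v : Word Ap) (n : ℕ) : val h (splice x n v) n = val h x n :=
  val_congr fun _ hj => splice_of_lt x v hj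

theorem val_splice_add (x v : Word Ap) (n m : ℕ) :
    val h (splice x n v) (n + m) = val h x n * val h v m := by
  rw [val_add, val_splice, suff_splice]

end Words

/-- A language recognised by the monoid morphism extending `h`: membership of a word is determined
by the values of the factors of any factorisation. -/
def Recognizes {Ap M : Type} [Monoid M] (h : Set Ap → M) (P : Set (Word Ap)) : Prop :=
  ∀ (w w' : Word Ap) (k k' : ℕ → ℕ), StrictMono k → StrictMono k' →
    val h w (k 0) = val h w' (k' 0) →
    (∀ i, val h (suff w (k i)) (k (i + 1) - k i) = val h (suff w' (k' i)) (k' (i + 1) - k' i)) →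
    (w ∈ P ↔ w' ∈ P)

/-- A finite reverse-deterministic automaton: the state `eval w` of a word is computed from its
first letter and the state of its tail, and it is determined by the transformations induced by the
factors of any factorisation. -/
structure RevAutomaton (Ap : Type) : Type 1 where
  S : Type
  fin : Finite S
  act : Set Ap → Function.End S
  eval : Word Ap → S
  eval_eq : ∀ w, eval w = act (w 0) (eval (suff w 1))
  aper : ∀ g ∈ Submonoid.closure (Set.range act), ∃ n : ℕ, g ^ (n + 1) = g ^ n
  lim : ∀ (w w' : Word Ap) (k k' : ℕ → ℕ), StrictMono k → StrictMono k' →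
    (∀ i, val act (suff w (k i)) (k (i + 1) - k i) = val act (suff w' (k' i)) (k' (i + 1) - k' i)) →
    eval (suff w (k 0)) = eval (suff w' (k' 0))

namespace RevAutomaton

variable {Ap : Type}

/-- The language `P` is a union of evaluation classes. -/
def Knows (T : RevAutomaton Ap) (P : Set (Word Ap)) : Prop :=
  ∃ out : T.S → Prop, ∀ w, w ∈ P ↔ out (T.eval w)

theorem eval_val (T : RevAutomaton Ap) (w : Word Ap) (n : ℕ) :
    T.eval w = val T.act w n (T.eval (suff w n)) := by
  induction n with
  | zero => rfl
  | succ n ih =>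
    rw [ih, T.eval_eq (suff w n), suff_suff, val_succ, suff_apply, zero_add]
    rfl

variable {T : RevAutomaton Ap} {P Q : Set (Word Ap)}

theorem Knows.compl (hP : T.Knows P) : T.Knows Pᶜ := by
  obtain ⟨f, hf⟩ := hP
  exact ⟨fun s => ¬ f s, fun w => by rw [Set.mem_compl_iff, hf]⟩

theorem Knows.inter (hP : T.Knows P) (hQ : T.Knows Q) : T.Knows (P ∩ Q) := by
  obtain ⟨f, hf⟩ := hP
  obtain ⟨g, hg⟩ := hQ
  exact ⟨fun s => f s ∧ g s, fun w => by rw [Set.mem_inter_iff, hf, hg]⟩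

theorem Knows.union (hP : T.Knows P) (hQ : T.Knows Q) : T.Knows (P ∪ Q) := by
  obtain ⟨f, hf⟩ := hP
  obtain ⟨g, hg⟩ := hQ
  exact ⟨fun s => f s ∨ g s, fun w => by rw [Set.mem_union, hf, hg]⟩

/-- The constant action of letters. -/
def letterAct (a : Set Ap) : Function.End (Set Ap) := fun _ => a

theorem val_letterAct (w : Word Ap) (n : ℕ) (s : Set Ap) : val letterAct w (n + 1) s = w 0 := by
  rw [val_succ']
  rfl

theorem letterAct_closure {g : Function.End (Set Ap)}
    (hg : g ∈ Submonoid.closure (Set.range (letterAct (Ap := Ap)))) :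
    g = 1 ∨ ∃ a, g = letterAct a := by
  induction hg using Submonoid.closure_induction with
  | mem g hg =>
    obtain ⟨a, rfl⟩ := hg
    exact Or.inr ⟨a, rfl⟩
  | one => exact Or.inl rfl
  | mul x y _ _ hx hy =>
    rcases hx with rfl | ⟨a, rfl⟩
    · rwa [one_mul]
    · exact Or.inr ⟨a, rfl⟩

/-- The automaton storing the first letter. -/
def letter (Ap : Type) [Finite Ap] : RevAutomaton Ap where
  S := Set Ap
  fin := inferInstance
  act := letterAct
  eval w := w 0
  eval_eq _ := rfl
  aper g hg := by
    refine ⟨1, ?_⟩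
    rcases letterAct_closure hg with rfl | ⟨a, rfl⟩
    · simp
    · rw [pow_succ, pow_one]
      rfl
  lim w w' k k' hk hk' hseg := by
    obtain ⟨m, hm⟩ := Nat.exists_eq_add_of_lt (hk (Nat.lt_add_one 0))
    obtain ⟨m', hm'⟩ := Nat.exists_eq_add_of_lt (hk' (Nat.lt_add_one 0))
    have h0 := hseg 0
    rw [show k (0 + 1) - k 0 = m + 1 by omega, show k' (0 + 1) - k' 0 = m' + 1 by omega] at h0
    rw [← val_letterAct (suff w (k 0)) m ∅, h0, val_letterAct]

/-- The words whose tail satisfies `P` until `Q`. -/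
def nextUntil (P Q : Set (Word Ap)) : Set (Word Ap) :=
  {w | ∃ k, suff w (k + 1) ∈ Q ∧ ∀ j < k, suff w (j + 1) ∈ P}

theorem mem_nextUntil_iff {w : Word Ap} :
    w ∈ nextUntil P Q ↔ suff w 1 ∈ Q ∨ (suff w 1 ∈ P ∧ suff w 1 ∈ nextUntil P Q) := by
  constructor
  · rintro ⟨_ | k, hQ, hP⟩
    · exact Or.inl hQ
    · refine Or.inr ⟨hP 0 k.succ_pos, k, ?_, fun j hj => ?_⟩
      · rwa [suff_suff, add_comm]
      · rw [suff_suff, add_comm]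
        exact hP (j + 1) (Nat.succ_lt_succ hj)
  · rintro (hQ | ⟨hP, k, hQ, hP'⟩)
    · exact ⟨0, hQ, by simp⟩
    · refine ⟨k + 1, ?_, fun j hj => ?_⟩
      · rwa [suff_suff, add_comm] at hQ
      · rcases j with _ | j
        · exact hP
        · have := hP' j (Nat.lt_of_succ_lt_succ hj)
          rwa [suff_suff, add_comm] at this

theorem iterate_monotone_prop {f : Prop → Prop} (hf : ∀ b b' : Prop, (b → b') → f b → f b')
    (b : Prop) : f (f b) = f b := by
  by_cases hb : b <;> by_cases h1 : f True <;> by_cases h2 : f False <;>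
    have := hf False True <;> simp_all

/-- The action storing one more bit, for the operator `nextUntil`. -/
def bitAct (T : RevAutomaton Ap) (p q : T.S → Prop) (a : Set Ap) : Function.End (T.S × Prop) :=
  fun s => (T.act a s.1, q s.1 ∨ (p s.1 ∧ s.2))

theorem bitAct_closure (T : RevAutomaton Ap) (p q : T.S → Prop) {g' : Function.End (T.S × Prop)}
    (hg' : g' ∈ Submonoid.closure (Set.range (bitAct T p q))) :
    ∃ g ∈ Submonoid.closure (Set.range T.act), (∀ s, (g' s).1 = g s.1) ∧
      ∀ (s : T.S) (b b' : Prop), (b → b') → (g' (s, b)).2 → (g' (s, b')).2 := by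
  induction hg' using Submonoid.closure_induction with
  | mem g' hg' =>
    obtain ⟨a, rfl⟩ := hg'
    refine ⟨T.act a, Submonoid.subset_closure ⟨a, rfl⟩, fun _ => rfl, fun s b b' hb => ?_⟩
    simp only [bitAct]
    tauto
  | one => exact ⟨1, one_mem _, fun _ => rfl, fun s b b' hb => hb⟩
  | mul x y _ _ hx hy =>
    obtain ⟨g₁, hg₁, h₁, h₁'⟩ := hx
    obtain ⟨g₂, hg₂, h₂, h₂'⟩ := hy
    refine ⟨g₁ * g₂, mul_mem hg₁ hg₂, fun s => ?_, fun s b b' hb => ?_⟩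
    · change (x (y s)).1 = g₁ (g₂ s.1)
      rw [h₁, h₂]
    · change (x (y (s, b))).2 → (x (y (s, b'))).2
      have e : y (s, b) = (g₂ s, (y (s, b)).2) := Prod.ext (h₂ _) rfl
      have e' : y (s, b') = (g₂ s, (y (s, b')).2) := Prod.ext (h₂ _) rfl
      rw [e, e']
      exact h₁' _ _ _ (h₂' s b b' hb)

theorem val_bitAct (T : RevAutomaton Ap) (p q : T.S → Prop) (w : Word Ap) (n : ℕ)
    (s : T.S × Prop) : (val (bitAct T p q) w n s).1 = val T.act w n s.1 := by
  induction n generalizing s with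
  | zero => rfl
  | succ n ih =>
    rw [val_succ, val_succ]
    change (val (bitAct T p q) w n _).1 = val T.act w n _
    rw [ih]
    rfl

theorem val_bitAct_false {p q : T.S → Prop} (hp : ∀ w, w ∈ P ↔ p (T.eval w))
    (hq : ∀ w, w ∈ Q ↔ q (T.eval w)) (w : Word Ap) (n : ℕ) :
    (val (bitAct T p q) w n (T.eval (suff w n), False)).2 ↔
      ∃ k < n, suff w (k + 1) ∈ Q ∧ ∀ j < k, suff w (j + 1) ∈ P := by
  induction n generalizing w with
  | zero =>
    change False ↔ _
    simp
  | succ n ih =>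
    have e : val (bitAct T p q) (suff w 1) n (T.eval (suff w (n + 1)), False) =
        (T.eval (suff w 1), ∃ k < n, suff w (k + 2) ∈ Q ∧ ∀ j < k, suff w (j + 2) ∈ P) := by
      have ih' := ih (suff w 1)
      simp only [suff_suff, add_comm 1, add_assoc, Nat.reduceAdd] at ih'
      refine Prod.ext ?_ (propext ih')
      rw [val_bitAct, T.eval_val (suff w 1) n, suff_suff, add_comm 1]
    rw [val_succ']
    change (bitAct T p q (w 0) (val (bitAct T p q) (suff w 1) n _)).2 ↔ _
    rw [e]
    simp only [bitAct, ← hp, ← hq]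
    constructor
    · rintro (h | ⟨h, k, hk, hQ, hP⟩)
      · exact ⟨0, n.succ_pos, h, by simp⟩
      · refine ⟨k + 1, Nat.succ_lt_succ hk, hQ, fun j hj => ?_⟩
        rcases j with _ | j
        · exact h
        · exact hP j (Nat.lt_of_succ_lt_succ hj)
    · rintro ⟨_ | k, hk, hQ, hP⟩
      · exact Or.inl hQ
      · exact Or.inr ⟨hP 0 k.succ_pos, k, Nat.lt_of_succ_lt_succ hk, hQ,
          fun j hj => hP (j + 1) (Nat.succ_lt_succ hj)⟩

theorem val_cuts_eq {M : Type} [Monoid M] {h : Set Ap → M} {w w' : Word Ap} {k k' : ℕ → ℕ}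
    (hk : StrictMono k) (hk' : StrictMono k')
    (hseg : ∀ i, val h (suff w (k i)) (k (i + 1) - k i) =
      val h (suff w' (k' i)) (k' (i + 1) - k' i)) (i : ℕ) :
    val h (suff w (k 0)) (k i - k 0) = val h (suff w' (k' 0)) (k' i - k' 0) := by
  induction i with
  | zero => simp
  | succ i ih =>
    have h1 := hk.monotone (Nat.zero_le i)
    have h2 := hk.monotone (Nat.le_succ i)
    have h1' := hk'.monotone (Nat.zero_le i)
    have h2' := hk'.monotone (Nat.le_succ i)
    rw [show k (i + 1) - k 0 = (k i - k 0) + (k (i + 1) - k i) by grind, val_add, suff_suff,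
      show k' (i + 1) - k' 0 = (k' i - k' 0) + (k' (i + 1) - k' i) by grind, val_add, suff_suff,
      ih, Nat.add_sub_cancel' h1, Nat.add_sub_cancel' h1', hseg]

theorem exists_extension (hP : T.Knows P) (hQ : T.Knows Q) :
    ∃ T' : RevAutomaton Ap, (∀ R, T.Knows R → T'.Knows R) ∧ T'.Knows (nextUntil P Q) := by
  obtain ⟨p, hp⟩ := hP
  obtain ⟨q, hq⟩ := hQ
  have := T.fin
  refine ⟨{ S := T.S × Prop, fin := inferInstance, act := bitAct T p q,
            eval := fun w => (T.eval w, w ∈ nextUntil P Q), eval_eq := fun w => ?_,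
            aper := fun g' hg' => ?_, lim := fun w w' k k' hk hk' hseg => ?_ }, ?_, ?_⟩
  · refine Prod.ext (T.eval_eq w) (propext ?_)
    rw [mem_nextUntil_iff, hp, hq]
    rfl
  · obtain ⟨g, hg, h1, h2⟩ := bitAct_closure T p q hg'
    obtain ⟨n, hn⟩ := T.aper g hg
    have hfst : ∀ (m : ℕ) (s : T.S × Prop), ((g' ^ m) s).1 = (g ^ m) s.1 := fun m => by
      induction m with
      | zero => exact fun _ => rfl
      | succ m ih =>
        intro s
        rw [pow_succ', pow_succ']
        change (g' ((g' ^ m) s)).1 = g ((g ^ m) s.1)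
        rw [h1, ih]
    refine ⟨n + 1, funext fun s => ?_⟩
    have hfix : g ((g ^ n) s.1) = (g ^ n) s.1 := by
      have := congrFun hn s.1
      rwa [pow_succ'] at this
    obtain ⟨b, hb⟩ : ∃ b, (g' ^ n) s = ((g ^ n) s.1, b) := ⟨_, Prod.ext (hfst n s) rfl⟩
    have hstep : ∀ b, g' ((g ^ n) s.1, b) = ((g ^ n) s.1, (g' ((g ^ n) s.1, b)).2) := fun b =>
      Prod.ext ((h1 _).trans hfix) rfl
    rw [pow_succ' _ (n + 1), pow_succ']
    change g' (g' ((g' ^ n) s)) = g' ((g' ^ n) s)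
    rw [hb, hstep b, hstep, iterate_monotone_prop (f := fun b => (g' ((g ^ n) s.1, b)).2)
      (fun b b' => h2 _ b b') b]
  · have hfst : ∀ i, val T.act (suff w (k i)) (k (i + 1) - k i) =
        val T.act (suff w' (k' i)) (k' (i + 1) - k' i) := fun i => by
      funext s
      rw [← val_bitAct T p q _ _ (s, False), hseg, val_bitAct]
    have hev : ∀ i, T.eval (suff w (k i)) = T.eval (suff w' (k' i)) := fun i => by
      have := T.lim w w' (fun j => k (j + i)) (fun j => k' (j + i))
        (hk.comp fun a b hab => Nat.add_lt_add_right hab i)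
        (hk'.comp fun a b hab => Nat.add_lt_add_right hab i)
        (fun j => by simpa only [add_right_comm] using hfst (j + i))
      simpa using this
    refine Prod.ext (hev 0) (propext ?_)
    have key : ∀ i, (∃ m < k i - k 0, suff (suff w (k 0)) (m + 1) ∈ Q ∧
          ∀ j < m, suff (suff w (k 0)) (j + 1) ∈ P) ↔
        ∃ m < k' i - k' 0, suff (suff w' (k' 0)) (m + 1) ∈ Q ∧
          ∀ j < m, suff (suff w' (k' 0)) (j + 1) ∈ P := fun i => by
      rw [← val_bitAct_false hp hq, ← val_bitAct_false hp hq, val_cuts_eq hk hk' hseg,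
        suff_suff, suff_suff, Nat.add_sub_cancel' (hk.monotone (Nat.zero_le i)),
        Nat.add_sub_cancel' (hk'.monotone (Nat.zero_le i)), hev]
    constructor
    · rintro ⟨m, hm⟩
      have := hk.le_apply (x := m + 1 + k 0)
      obtain ⟨m', -, hm'⟩ := (key (m + 1 + k 0)).1 ⟨m, by omega, hm⟩
      exact ⟨m', hm'⟩
    · rintro ⟨m, hm⟩
      have := hk'.le_apply (x := m + 1 + k' 0)
      obtain ⟨m', -, hm'⟩ := (key (m + 1 + k' 0)).2 ⟨m, by omega, hm⟩
      exact ⟨m', hm'⟩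
  · rintro R ⟨r, hr⟩
    exact ⟨fun s => r s.1, hr⟩
  · exact ⟨fun s => s.2, fun w => Iff.rfl⟩

theorem exists_until (hP : T.Knows P) (hQ : T.Knows Q) :
    ∃ T' : RevAutomaton Ap, (∀ R, T.Knows R → T'.Knows R) ∧
      T'.Knows {w | ∃ k, suff w k ∈ Q ∧ ∀ j < k, suff w j ∈ P} := by
  obtain ⟨T', hT, hU⟩ := exists_extension hP hQ
  refine ⟨T', hT, ?_⟩
  convert (hT Q hQ).union ((hT P hP).inter hU) using 1
  ext w
  constructor
  · rintro ⟨_ | k, hQ, hP⟩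
    · exact Or.inl hQ
    · exact Or.inr ⟨hP 0 k.succ_pos, k, hQ, fun j hj => hP _ (Nat.succ_lt_succ hj)⟩
  · rintro (hQ | ⟨hP, k, hQ, hP'⟩)
    · exact ⟨0, hQ, by simp⟩
    · refine ⟨k + 1, hQ, fun j hj => ?_⟩
      rcases j with _ | j
      · exact hP
      · exact hP' j (Nat.lt_of_succ_lt_succ hj)

theorem exists_knows (φ : F Ap) : ∀ T₀ : RevAutomaton Ap, (∀ a, T₀.Knows {w | a ∈ w 0}) →
    ∃ T : RevAutomaton Ap, (∀ R, T₀.Knows R → T.Knows R) ∧ T.Knows (Lang φ) := by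
  have aux : ∀ φ ψ : F Ap,
      (∀ T₀ : RevAutomaton Ap, (∀ a, T₀.Knows {w | a ∈ w 0}) →
        ∃ T : RevAutomaton Ap, (∀ R, T₀.Knows R → T.Knows R) ∧ T.Knows (Lang φ)) →
      (∀ T₀ : RevAutomaton Ap, (∀ a, T₀.Knows {w | a ∈ w 0}) →
        ∃ T : RevAutomaton Ap, (∀ R, T₀.Knows R → T.Knows R) ∧ T.Knows (Lang ψ)) →
      ∀ T₀ : RevAutomaton Ap, (∀ a, T₀.Knows {w | a ∈ w 0}) →
        ∃ T : RevAutomaton Ap, (∀ R, T₀.Knows R → T.Knows R) ∧ T.Knows (Lang φ) ∧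
          T.Knows (Lang ψ) := by
    intro φ ψ hφ hψ T₀ h₀
    obtain ⟨T₁, h1, hφ⟩ := hφ T₀ h₀
    obtain ⟨T₂, h2, hψ⟩ := hψ T₁ fun a => h1 _ (h₀ a)
    exact ⟨T₂, fun R hR => h2 R (h1 R hR), h2 _ hφ, hψ⟩
  induction φ with
  | tt => exact fun T₀ h₀ => ⟨T₀, fun _ => id, fun _ => True, fun _ => Iff.rfl⟩
  | ff => exact fun T₀ h₀ => ⟨T₀, fun _ => id, fun _ => False, fun _ => Iff.rfl⟩
  | pos a => exact fun T₀ h₀ => ⟨T₀, fun _ => id, h₀ a⟩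
  | nlit a => exact fun T₀ h₀ => ⟨T₀, fun _ => id, (h₀ a).compl⟩
  | and φ ψ ihφ ihψ =>
    intro T₀ h₀
    obtain ⟨T, hT, hφ, hψ⟩ := aux φ ψ ihφ ihψ T₀ h₀
    exact ⟨T, hT, hφ.inter hψ⟩
  | or φ ψ ihφ ihψ =>
    intro T₀ h₀
    obtain ⟨T, hT, hφ, hψ⟩ := aux φ ψ ihφ ihψ T₀ h₀
    exact ⟨T, hT, hφ.union hψ⟩
  | next φ ih =>
    intro T₀ h₀
    obtain ⟨T, hT, hφ⟩ := ih T₀ h₀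
    obtain ⟨T', hT', hU⟩ := exists_extension (T := T) (P := ∅) ⟨fun _ => False, fun _ => Iff.rfl⟩ hφ
    refine ⟨T', fun R hR => hT' R (hT R hR), ?_⟩
    convert hU using 1
    ext w
    exact ⟨fun hw => ⟨0, hw, by simp⟩, fun ⟨k, hk, hk'⟩ => by
      rcases k with _ | k
      · exact hk
      · exact (hk' 0 k.succ_pos).elim⟩
  | untl φ ψ ihφ ihψ =>
    intro T₀ h₀
    obtain ⟨T, hT, hφ, hψ⟩ := aux φ ψ ihφ ihψ T₀ h₀
    obtain ⟨T', hT', hU⟩ := exists_until hφ hψ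
    exact ⟨T', fun R hR => hT' R (hT R hR), hU⟩
  | wuntl φ ψ ihφ ihψ =>
    intro T₀ h₀
    obtain ⟨T, hT, hφ, hψ⟩ := aux φ ψ ihφ ihψ T₀ h₀
    obtain ⟨T', hT', hU⟩ := exists_until hψ.compl (hφ.compl.inter hψ.compl)
    refine ⟨T', fun R hR => hT' R (hT R hR), ?_⟩
    convert hU.compl using 1
    ext w
    exact sat_wuntl_iff w φ ψ
  | rel φ ψ ihφ ihψ =>
    intro T₀ h₀
    obtain ⟨T, hT, hφ, hψ⟩ := aux φ ψ ihφ ihψ T₀ h₀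
    obtain ⟨T', hT', hU⟩ := exists_until hφ.compl hψ.compl
    refine ⟨T', fun R hR => hT' R (hT R hR), ?_⟩
    convert hU.compl using 1
    ext w
    exact sat_rel_iff w φ ψ
  | srel φ ψ ihφ ihψ =>
    intro T₀ h₀
    obtain ⟨T, hT, hφ, hψ⟩ := aux φ ψ ihφ ihψ T₀ h₀
    obtain ⟨T', hT', hU⟩ := exists_until hψ (hφ.inter hψ)
    refine ⟨T', fun R hR => hT' R (hT R hR), ?_⟩
    convert hU using 1
    ext w
    exact sat_srel_iff w φ ψ

end RevAutomaton

theorem exists_recognizes {Ap : Type} [Finite Ap] (φ : F Ap) :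
    ∃ (M : Type) (_ : Monoid M) (_ : Finite M) (h : Set Ap → M),
      Aperiodic M ∧ Recognizes h (Lang φ) := by
  obtain ⟨T, -, out, hout⟩ := RevAutomaton.exists_knows φ (RevAutomaton.letter Ap)
    fun a => ⟨fun s : Set Ap => a ∈ s, fun _ => Iff.rfl⟩
  have := T.fin
  have : Finite (Function.End T.S) := inferInstanceAs (Finite (T.S → T.S))
  let M := Submonoid.closure (Set.range T.act)
  let h : Set Ap → M := fun a => ⟨T.act a, Submonoid.subset_closure ⟨a, rfl⟩⟩
  have hval : ∀ w n, ((val h w n : M) : Function.End T.S) = val T.act w n := fun w n => by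
    induction n with
    | zero => rfl
    | succ n ih => rw [val_succ, val_succ, ← ih]; rfl
  refine ⟨M, inferInstance, inferInstance, h, ?_, ?_⟩
  · rintro ⟨g, hg⟩
    obtain ⟨n, hn⟩ := T.aper g hg
    exact ⟨n, Subtype.ext hn⟩
  · intro w w' k k' hk hk' h0 hseg
    have := T.lim w w' k k' hk hk' fun i => by rw [← hval, ← hval, hseg]
    rw [hout, hout, T.eval_val w (k 0), T.eval_val w' (k' 0), this, ← hval, h0, hval]


/-! ### Topological characterisations of the semantic classes -/

section Semantics

variable {Ap : Type}

/-- `P` is open in the prefix topology. -/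
def PrefixOpen (P : Set (Word Ap)) : Prop :=
  ∀ w ∈ P, ∃ n, ∀ w' : Word Ap, (∀ j < n, w' j = w j) → w' ∈ P

/-- `P` is a countable union of sets closed in the prefix topology. -/
def PrefixFSigma (P : Set (Word Ap)) : Prop :=
  ∃ C : ℕ → Set (Word Ap), (∀ k, PrefixOpen (C k)ᶜ) ∧ P = ⋃ k, C k

theorem length_pre (w : Word Ap) (n : ℕ) : (pre w n).length = n := by simp [pre]

theorem pre_eq_pre_iff {w w' : Word Ap} {n : ℕ} :
    pre w n = pre w' n ↔ ∀ j < n, w j = w' j := by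
  simp [pre]

theorem guaranteeP_iff {P : Set (Word Ap)} : GuaranteeP P ↔ PrefixOpen P := by
  constructor
  · rintro ⟨L, hL⟩ w hw
    obtain ⟨n, hn⟩ := (hL w).1 hw
    refine ⟨n, fun w' hw' => (hL w').2 ⟨n, ?_⟩⟩
    rwa [pre_eq_pre_iff.2 hw']
  · intro hP
    refine ⟨{u | ∃ w n, u = pre w n ∧ ∀ w' : Word Ap, (∀ j < n, w' j = w j) → w' ∈ P},
      fun w => ⟨fun hw => ?_, ?_⟩⟩
    · obtain ⟨n, hn⟩ := hP w hw
      exact ⟨n, w, n, rfl, hn⟩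
    · rintro ⟨n, w', n', hpre, h⟩
      obtain rfl : n = n' := by rw [← length_pre w n, hpre, length_pre]
      exact h w (pre_eq_pre_iff.1 hpre)

theorem guaranteeP_compl_iff {P : Set (Word Ap)} : GuaranteeP Pᶜ ↔ SafetyP P := by
  constructor
  · rintro ⟨L, hL⟩
    refine ⟨Lᶜ, fun w => ?_⟩
    have := hL w
    rw [Set.mem_compl_iff, not_iff_comm] at this
    simp [← this]
  · rintro ⟨L, hL⟩
    exact ⟨Lᶜ, fun w => by simp [hL]⟩

theorem not_infinite_iff {p : ℕ → Prop} :
    ¬ {n | p n}.Infinite ↔ ∃ m, ∀ n ≥ m, ¬ p n := by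
  rw [← Nat.frequently_atTop_iff_infinite, Filter.not_frequently, Filter.eventually_atTop]

theorem persistenceP_compl_iff {P : Set (Word Ap)} : PersistenceP Pᶜ ↔ RecurrenceP P := by
  constructor
  · rintro ⟨L, hL⟩
    refine ⟨Lᶜ, fun w => ?_⟩
    have := hL w
    rw [Set.mem_compl_iff, not_iff_comm] at this
    rw [← this, ← not_iff_not, not_infinite_iff]
    simp
  · rintro ⟨L, hL⟩
    refine ⟨Lᶜ, fun w => ?_⟩
    rw [Set.mem_compl_iff, hL, not_infinite_iff]
    rfl

theorem persistenceP_iff {P : Set (Word Ap)} : PersistenceP P ↔ PrefixFSigma P := by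
  classical
  constructor
  · rintro ⟨L, hL⟩
    refine ⟨fun m => {w | ∀ n ≥ m, pre w n ∈ L}, fun m w hw => ?_, ?_⟩
    · simp only [Set.mem_compl_iff, Set.mem_ofPred_eq, not_forall] at hw
      obtain ⟨n, hn, hw⟩ := hw
      refine ⟨n, fun w' hw' h => hw ?_⟩
      rw [← pre_eq_pre_iff.2 hw']
      exact h n hn
    · ext w
      simp [hL]
  · rintro ⟨C, hC, rfl⟩
    let good : Word Ap → ℕ → ℕ → Prop := fun w n k => n ≤ k ∨ ∃ w' ∈ C k, ∀ j < n, w' j = w j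
    have hgood : ∀ w n, ∃ k, good w n k := fun w n => ⟨n, Or.inl le_rfl⟩
    let f : Word Ap → ℕ → ℕ := fun w n => Nat.find (hgood w n)
    have f_congr : ∀ w w' n, (∀ j < n, w j = w' j) → f w n = f w' n := by
      intro w w' n h
      refine Nat.find_congr' fun {k} => or_congr_right (exists_congr fun x => and_congr_right fun _ =>
        forall₂_congr fun j hj => by rw [h j hj])
    have f_mono : ∀ w, Monotone (f w) := fun w => monotone_nat_of_le_succ fun n =>
      Nat.find_min' _ <| Or.imp (fun h => (Nat.le_succ n).trans h)
        (fun ⟨w', hw', h⟩ => ⟨w', hw', fun j hj => h j (hj.trans n.lt_succ_self)⟩)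
        (Nat.find_spec (hgood w (n + 1)))
    have hL : ∀ w n, (∃ w' n', pre w (n + 1) = pre w' (n' + 1) ∧ f w' (n' + 1) = f w' n') ↔
        f w (n + 1) = f w n := by
      refine fun w n => ⟨?_, fun h => ⟨w, n, rfl, h⟩⟩
      rintro ⟨w', n', hpre, h⟩
      obtain rfl : n = n' := by
        have := congrArg List.length hpre
        simpa only [length_pre, add_left_inj] using this
      have hw := pre_eq_pre_iff.1 hpre
      rwa [f_congr w w' _ hw, f_congr w w' n fun j hj => hw j (by omega)]
    refine ⟨{u | ∃ w n, u = pre w (n + 1) ∧ f w (n + 1) = f w n}, fun w => ?_⟩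
    rw [Set.mem_iUnion]
    constructor
    · rintro ⟨k, hk⟩
      have hb : ∀ n, f w n ≤ k := fun n => Nat.find_min' _ (Or.inr ⟨w, hk, fun _ _ => rfl⟩)
      obtain ⟨m, hm⟩ : ∃ m, ∀ n, f w n ≤ f w m := by
        by_contra! hcon
        have : ∀ i, ∃ n, i ≤ f w n := fun i => by
          induction i with
          | zero => exact ⟨0, Nat.zero_le _⟩
          | succ i ih =>
            obtain ⟨n, hn⟩ := ih
            obtain ⟨n', hn'⟩ := hcon n
            exact ⟨n', by omega⟩
        obtain ⟨n, hn⟩ := this (k + 1)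
        have := hb n
        omega
      refine ⟨m + 1, fun n hn => ?_⟩
      obtain ⟨n, rfl⟩ := Nat.exists_eq_add_of_le' (Nat.le_of_add_left_le hn : 1 ≤ n)
      refine (hL w n).2 (le_antisymm ((hm _).trans (f_mono w (by omega))) (f_mono w (by omega)))
    · rintro ⟨m, hm⟩
      have hst : ∀ n ≥ m, f w n = f w m := fun n hn => by
        induction n, hn using Nat.le_induction with
        | base => rfl
        | succ n hn ih => rw [← ih]; exact (hL w n).1 (hm (n + 1) (by omega))
      refine ⟨f w m, ?_⟩
      by_contra hw
      obtain ⟨n, hn⟩ := hC _ w hw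
      have hspec := Nat.find_spec (hgood w (n + m + f w m + 1))
      have heq : Nat.find (hgood w (n + m + f w m + 1)) = f w m := hst _ (by omega)
      rw [heq] at hspec
      rcases hspec with h | ⟨w', hw', h⟩
      · omega
      · exact hn w' (fun j hj => h j (by omega)) hw'

/-! ### Soundness of the syntactic classes -/

/-- A class of languages containing the literals and closed under finite intersections, countable
unions and shifts. -/
structure UnionClosed (K : Set (Set (Word Ap))) : Prop where
  univ : Set.univ ∈ K
  inter : ∀ {P Q}, P ∈ K → Q ∈ K → P ∩ Q ∈ K
  iUnion : ∀ f : ℕ → Set (Word Ap), (∀ n, f n ∈ K) → (⋃ n, f n) ∈ K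
  shift : ∀ {P} (n : ℕ), P ∈ K → {w | suff w n ∈ P} ∈ K

theorem UnionClosed.until_mem {K : Set (Set (Word Ap))} (hK : UnionClosed K) {P Q : Set (Word Ap)}
    (hP : P ∈ K) (hQ : Q ∈ K) : {w | ∃ k, suff w k ∈ Q ∧ ∀ j < k, suff w j ∈ P} ∈ K := by
  convert hK.iUnion _ fun k => hK.inter (hK.shift k hQ)
    (biInter_mem_of_finite hK.univ hK.inter (Set.finite_Iio k) _ fun j _ => hK.shift j hP) using 1
  ext w
  simp

theorem unionClosed_open : UnionClosed {P : Set (Word Ap) | PrefixOpen P} where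
  univ := fun _ _ => ⟨0, fun _ _ => trivial⟩
  inter := fun hP hQ w hw => by
    obtain ⟨m, hm⟩ := hP w hw.1
    obtain ⟨n, hn⟩ := hQ w hw.2
    exact ⟨max m n, fun w' hw' => ⟨hm w' fun j hj => hw' j (lt_max_of_lt_left hj),
      hn w' fun j hj => hw' j (lt_max_of_lt_right hj)⟩⟩
  iUnion := fun f hf w hw => by
    obtain ⟨i, hi⟩ := Set.mem_iUnion.1 hw
    obtain ⟨n, hn⟩ := hf i w hi
    exact ⟨n, fun w' hw' => Set.mem_iUnion.2 ⟨i, hn w' hw'⟩⟩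
  shift := fun m hP w hw => by
    obtain ⟨n, hn⟩ := hP _ hw
    exact ⟨n + m, fun w' hw' => hn _ fun j hj => hw' (j + m) (by omega)⟩

theorem PrefixOpen.inter {P Q : Set (Word Ap)} (hP : PrefixOpen P) (hQ : PrefixOpen Q) :
    PrefixOpen (P ∩ Q) := unionClosed_open.inter hP hQ

theorem PrefixOpen.union {P Q : Set (Word Ap)} (hP : PrefixOpen P) (hQ : PrefixOpen Q) :
    PrefixOpen (P ∪ Q) := by
  rintro w (hw | hw)
  · obtain ⟨n, hn⟩ := hP w hw
    exact ⟨n, fun w' hw' => Or.inl (hn w' hw')⟩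
  · obtain ⟨n, hn⟩ := hQ w hw
    exact ⟨n, fun w' hw' => Or.inr (hn w' hw')⟩

theorem PrefixFSigma.of_open_compl {P : Set (Word Ap)} (hP : PrefixOpen Pᶜ) : PrefixFSigma P :=
  ⟨fun _ => P, fun _ => hP, (Set.iUnion_const P).symm⟩

theorem PrefixOpen.fSigma {P : Set (Word Ap)} (hP : PrefixOpen P) : PrefixFSigma P := by
  refine ⟨fun n => {w | ∀ w' : Word Ap, (∀ j < n, w' j = w j) → w' ∈ P}, fun n w hw => ?_, ?_⟩
  · refine ⟨n, fun w₂ hw₂ h => hw fun w' hw' => h w' fun j hj => ?_⟩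
    rw [hw' j hj, hw₂ j hj]
  · ext w
    rw [Set.mem_iUnion]
    exact ⟨hP w, fun ⟨n, hn⟩ => hn w fun _ _ => rfl⟩

theorem unionClosed_fSigma : UnionClosed {P : Set (Word Ap) | PrefixFSigma P} where
  univ := PrefixFSigma.of_open_compl (by simp [PrefixOpen])
  inter := by
    rintro _ _ ⟨C, hC, rfl⟩ ⟨D, hD, rfl⟩
    refine ⟨fun k => C k.unpair.1 ∩ D k.unpair.2, fun k => ?_, ?_⟩
    · rw [Set.compl_inter]
      exact (hC _).union (hD _)
    · rw [Set.iUnion_unpair (f := fun i j => C i ∩ D j), Set.iUnion_inter_iUnion]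
  iUnion := fun f hf => by
    choose C hC hf using hf
    refine ⟨fun k => C k.unpair.1 k.unpair.2, fun k => hC _ _, ?_⟩
    rw [Set.iUnion_unpair (f := fun i j => C i j)]
    exact Set.iUnion_congr hf
  shift := by
    rintro _ n ⟨C, hC, rfl⟩
    refine ⟨fun k => {w | suff w n ∈ C k}, fun k => unionClosed_open.shift n (hC k), ?_⟩
    ext w
    simp

/-- The semantic class of the languages of `Σ_i` formulas, trivial from level three on. -/
def SemSigma (Ap : Type) : ℕ → Set (Set (Word Ap))
  | 0 => {P | PrefixOpen P ∧ PrefixOpen Pᶜ}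
  | 1 => {P | PrefixOpen P}
  | 2 => {P | PrefixFSigma P}
  | _ => Set.univ

theorem unionClosed_semSigma : ∀ i, UnionClosed (SemSigma Ap (i + 1))
  | 0 => unionClosed_open
  | 1 => unionClosed_fSigma
  | _ + 2 => ⟨trivial, fun _ _ => trivial, fun _ _ => trivial, fun _ _ => trivial⟩

theorem semSigma_succ_of_compl : ∀ (i : ℕ) {P : Set (Word Ap)},
    Pᶜ ∈ SemSigma Ap i → P ∈ SemSigma Ap (i + 1)
  | 0, P, h => by rw [← compl_compl P]; exact h.2
  | 1, _, h => PrefixFSigma.of_open_compl h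
  | _ + 2, _, _ => trivial

theorem semSigma_inter : ∀ (i : ℕ) {P Q : Set (Word Ap)},
    P ∈ SemSigma Ap i → Q ∈ SemSigma Ap i → P ∩ Q ∈ SemSigma Ap i
  | 0, P, Q, hP, hQ => ⟨hP.1.inter hQ.1, by rw [Set.compl_inter]; exact hP.2.union hQ.2⟩
  | i + 1, _, _, hP, hQ => (unionClosed_semSigma i).inter hP hQ

theorem semSigma_union : ∀ (i : ℕ) {P Q : Set (Word Ap)},
    P ∈ SemSigma Ap i → Q ∈ SemSigma Ap i → P ∪ Q ∈ SemSigma Ap i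
  | 0, P, Q, hP, hQ => ⟨hP.1.union hQ.1, by rw [Set.compl_union]; exact hP.2.inter hQ.2⟩
  | i + 1, P, Q, hP, hQ => by
    convert (unionClosed_semSigma i).iUnion (fun n => if n = 0 then P else Q)
      fun n => by split_ifs <;> assumption
    ext w
    simp only [Set.mem_union, Set.mem_iUnion]
    refine ⟨fun h => h.elim (fun h => ⟨0, by simpa⟩) fun h => ⟨1, by simpa⟩, fun ⟨n, hn⟩ => ?_⟩
    split_ifs at hn
    · exact Or.inl hn
    · exact Or.inr hn

theorem semSigma_of_letter {P : Set (Word Ap)} (hP : ∀ w w' : Word Ap, w 0 = w' 0 → w ∈ P → w' ∈ P) :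
    ∀ i, P ∈ SemSigma Ap i := by
  have h1 : PrefixOpen P := fun w hw => ⟨1, fun w' hw' => hP w w' (hw' 0 one_pos).symm hw⟩
  have h2 : PrefixOpen Pᶜ := fun w hw => ⟨1, fun w' hw' h => hw (hP w' w (hw' 0 one_pos) h)⟩
  rintro (_ | _ | _ | i)
  · exact ⟨h1, h2⟩
  · exact h1
  · exact PrefixFSigma.of_open_compl h2
  · trivial

theorem lang_untl (φ ψ : F Ap) :
    Lang (F.untl φ ψ) = {w | ∃ k, suff w k ∈ Lang ψ ∧ ∀ j < k, suff w j ∈ Lang φ} := rfl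

theorem lang_srel (φ ψ : F Ap) : Lang (F.srel φ ψ) =
    {w | ∃ k, suff w k ∈ Lang φ ∩ Lang ψ ∧ ∀ j < k, suff w j ∈ Lang ψ} :=
  Set.ext fun w => sat_srel_iff w φ ψ

theorem lang_rel_compl (φ ψ : F Ap) : (Lang (F.rel φ ψ))ᶜ =
    {w | ∃ k, suff w k ∈ (Lang ψ)ᶜ ∧ ∀ j < k, suff w j ∈ (Lang φ)ᶜ} :=
  Set.ext fun w => not_iff_comm.1 (sat_rel_iff w φ ψ).symm

theorem lang_wuntl_compl (φ ψ : F Ap) : (Lang (F.wuntl φ ψ))ᶜ =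
    {w | ∃ k, suff w k ∈ (Lang φ)ᶜ ∩ (Lang ψ)ᶜ ∧ ∀ j < k, suff w j ∈ (Lang ψ)ᶜ} :=
  Set.ext fun w => not_iff_comm.1 (sat_wuntl_iff w φ ψ).symm

mutual

theorem SigmaC.lang_mem : ∀ {i : ℕ} {φ : F Ap}, SigmaC Ap i φ → Lang φ ∈ SemSigma Ap i
  | i, _, .tt _ => semSigma_of_letter (fun _ _ _ _ => trivial) i
  | i, _, .ff _ => semSigma_of_letter (fun _ _ _ h => h) i
  | i, _, .pos _ a => semSigma_of_letter (fun w w' h hw => show a ∈ w' 0 from h ▸ hw) i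
  | i, _, .nlit _ a => semSigma_of_letter (fun w w' h hw => show a ∉ w' 0 from h ▸ hw) i
  | i, _, .and hφ hψ => semSigma_inter i hφ.lang_mem hψ.lang_mem
  | i, _, .or hφ hψ => semSigma_union i hφ.lang_mem hψ.lang_mem
  | _, _, .ofPi hφ => semSigma_succ_of_compl _ hφ.lang_compl_mem
  | _, _, .next hφ => (unionClosed_semSigma _).shift 1 hφ.lang_mem
  | _, _, .untl hφ hψ => by
    rw [lang_untl]
    exact (unionClosed_semSigma _).until_mem hφ.lang_mem hψ.lang_mem
  | _, _, .srel hφ hψ => by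
    rw [lang_srel]
    exact (unionClosed_semSigma _).until_mem hψ.lang_mem
      ((unionClosed_semSigma _).inter hφ.lang_mem hψ.lang_mem)

theorem PiC.lang_compl_mem : ∀ {i : ℕ} {φ : F Ap}, PiC Ap i φ → (Lang φ)ᶜ ∈ SemSigma Ap i
  | i, _, .tt _ => semSigma_of_letter (fun _ _ _ h => h) i
  | i, _, .ff _ => semSigma_of_letter (fun _ _ _ h => h) i
  | i, _, .pos _ a => semSigma_of_letter (fun w w' h hw => show a ∉ w' 0 from h ▸ hw) i
  | i, _, .nlit _ a => semSigma_of_letter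
    (fun w w' h hw => show ¬ a ∉ w' 0 from h ▸ hw) i
  | i, _, .and (φ := φ) (ψ := ψ) hφ hψ => by
    rw [show Lang (F.and φ ψ) = Lang φ ∩ Lang ψ from rfl, Set.compl_inter]
    exact semSigma_union i hφ.lang_compl_mem hψ.lang_compl_mem
  | i, _, .or (φ := φ) (ψ := ψ) hφ hψ => by
    rw [show Lang (F.or φ ψ) = Lang φ ∪ Lang ψ from rfl, Set.compl_union]
    exact semSigma_inter i hφ.lang_compl_mem hψ.lang_compl_mem
  | _, _, .ofSigma hφ => semSigma_succ_of_compl _ (by rw [compl_compl]; exact hφ.lang_mem)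
  | _, _, .next hφ => (unionClosed_semSigma _).shift 1 hφ.lang_compl_mem
  | _, _, .rel hφ hψ => by
    rw [lang_rel_compl]
    exact (unionClosed_semSigma _).until_mem hφ.lang_compl_mem hψ.lang_compl_mem
  | _, _, .wuntl hφ hψ => by
    rw [lang_wuntl_compl]
    exact (unionClosed_semSigma _).until_mem hψ.lang_compl_mem
      ((unionClosed_semSigma _).inter hφ.lang_compl_mem hψ.lang_compl_mem)

end

theorem DeltaC.posBool {i : ℕ} {φ : F Ap} (hφ : DeltaC Ap i φ) :
    PosBool Ap (fun Q => Q ∈ SemSigma Ap i ∨ Qᶜ ∈ SemSigma Ap i) (Lang φ) := by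
  induction hφ with
  | ofSigma h => exact .base (Or.inl h.lang_mem)
  | ofPi h => exact .base (Or.inr h.lang_compl_mem)
  | and _ _ h₁ h₂ => exact .inter h₁ h₂
  | or _ _ h₁ h₂ => exact .union h₁ h₂

theorem PosBool.mono {b b' : Set (Word Ap) → Prop} (hb : ∀ Q, b Q → b' Q) {P : Set (Word Ap)}
    (hP : PosBool Ap b P) : PosBool Ap b' P := by
  induction hP with
  | base h => exact .base (hb _ h)
  | inter _ _ h₁ h₂ => exact .inter h₁ h₂
  | union _ _ h₁ h₂ => exact .union h₁ h₂

theorem DeltaC.obligationP {φ : F Ap} (hφ : DeltaC Ap 1 φ) : ObligationP (Lang φ) :=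
  hφ.posBool.mono fun _ h => h.symm.imp (fun h => guaranteeP_compl_iff.1 (guaranteeP_iff.2 h))
    guaranteeP_iff.2

theorem DeltaC.reactivityP {φ : F Ap} (hφ : DeltaC Ap 2 φ) : ReactivityP (Lang φ) :=
  hφ.posBool.mono fun _ h => h.symm.imp
    (fun h => persistenceP_compl_iff.1 (persistenceP_iff.2 h)) persistenceP_iff.2

theorem ObligationP.persistenceP {P : Set (Word Ap)} (hP : ObligationP P) :
    PersistenceP P ∧ PersistenceP Pᶜ := by
  simp only [persistenceP_iff]
  have h₁ : ∀ {Q : Set (Word Ap)}, PrefixOpen Q → Q ∈ SemSigma Ap 2 ∧ Qᶜ ∈ SemSigma Ap 2 :=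
    fun h => ⟨h.fSigma, PrefixFSigma.of_open_compl (by rwa [compl_compl])⟩
  have key : P ∈ SemSigma Ap 2 ∧ Pᶜ ∈ SemSigma Ap 2 := by
    induction hP with
    | base h =>
      rcases h with h | h
      · rw [← guaranteeP_compl_iff, guaranteeP_iff] at h
        have := (h₁ h).symm
        rwa [compl_compl] at this
      · exact h₁ (guaranteeP_iff.1 h)
    | inter _ _ h₁ h₂ =>
      exact ⟨semSigma_inter 2 h₁.1 h₂.1, by
        rw [Set.compl_inter]; exact semSigma_union 2 h₁.2 h₂.2⟩
    | union _ _ h₁ h₂ =>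
      exact ⟨semSigma_union 2 h₁.1 h₂.1, by
        rw [Set.compl_union]; exact semSigma_inter 2 h₁.2 h₂.2⟩
  exact key

end Semantics


/-! ### Definability -/

section Definability

variable {Ap : Type}

theorem lang_dual (φ : F Ap) : Lang (dual φ) = (Lang φ)ᶜ := by
  induction φ with
  | tt => exact Set.compl_univ.symm
  | ff => exact Set.compl_empty.symm
  | pos a => rfl
  | nlit a => exact Set.ext fun w => not_not.symm
  | and φ ψ hφ hψ =>
    rw [show Lang (F.and φ ψ) = Lang φ ∩ Lang ψ from rfl, Set.compl_inter, ← hφ, ← hψ]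
    rfl
  | or φ ψ hφ hψ =>
    rw [show Lang (F.or φ ψ) = Lang φ ∪ Lang ψ from rfl, Set.compl_union, ← hφ, ← hψ]
    rfl
  | next φ hφ =>
    exact Set.ext fun w => Set.ext_iff.1 hφ (suff w 1)
  | untl φ ψ hφ hψ =>
    rw [dual, ← compl_compl (Lang (F.rel _ _)), lang_rel_compl, hφ, hψ, compl_compl, compl_compl,
      lang_untl]
  | srel φ ψ hφ hψ =>
    rw [dual, ← compl_compl (Lang (F.wuntl _ _)), lang_wuntl_compl, hφ, hψ, compl_compl,
      compl_compl, lang_srel]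
  | rel φ ψ hφ hψ => rw [dual, lang_rel_compl, lang_untl, hφ, hψ]
  | wuntl φ ψ hφ hψ => rw [dual, lang_wuntl_compl, lang_srel, hφ, hψ]

mutual

theorem SigmaC.dual : ∀ {i : ℕ} {φ : F Ap}, SigmaC Ap i φ → PiC Ap i (dual φ)
  | _, _, .tt i => .ff i
  | _, _, .ff i => .tt i
  | _, _, .pos i a => .nlit i a
  | _, _, .nlit i a => .pos i a
  | _, _, .and hφ hψ => .or hφ.dual hψ.dual
  | _, _, .or hφ hψ => .and hφ.dual hψ.dual
  | _, _, .ofPi hφ => .ofSigma hφ.dual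
  | _, _, .next hφ => .next hφ.dual
  | _, _, .untl hφ hψ => .rel hφ.dual hψ.dual
  | _, _, .srel hφ hψ => .wuntl hφ.dual hψ.dual

theorem PiC.dual : ∀ {i : ℕ} {φ : F Ap}, PiC Ap i φ → SigmaC Ap i (dual φ)
  | _, _, .tt i => .ff i
  | _, _, .ff i => .tt i
  | _, _, .pos i a => .nlit i a
  | _, _, .nlit i a => .pos i a
  | _, _, .and hφ hψ => .or hφ.dual hψ.dual
  | _, _, .or hφ hψ => .and hφ.dual hψ.dual
  | _, _, .ofSigma hφ => .ofPi hφ.dual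
  | _, _, .next hφ => .next hφ.dual
  | _, _, .rel hφ hψ => .untl hφ.dual hψ.dual
  | _, _, .wuntl hφ hψ => .srel hφ.dual hψ.dual

end

/-- The languages of `Σ_i` formulas. -/
def SigmaDef (Ap : Type) (i : ℕ) : Set (Set (Word Ap)) :=
  {P | ∃ ψ : F Ap, SigmaC Ap i ψ ∧ P = Lang ψ}

/-- The languages of `Π_i` formulas. -/
def PiDef (Ap : Type) (i : ℕ) : Set (Set (Word Ap)) :=
  {P | ∃ ψ : F Ap, PiC Ap i ψ ∧ P = Lang ψ}

/-- The languages of `Δ_i` formulas. -/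
def DeltaDef (Ap : Type) (i : ℕ) : Set (Set (Word Ap)) :=
  {P | ∃ ψ : F Ap, DeltaC Ap i ψ ∧ P = Lang ψ}

variable {i : ℕ} {P Q : Set (Word Ap)}

theorem compl_mem_piDef (hP : P ∈ SigmaDef Ap i) : Pᶜ ∈ PiDef Ap i := by
  obtain ⟨ψ, hψ, rfl⟩ := hP
  exact ⟨dual ψ, hψ.dual, (lang_dual ψ).symm⟩

theorem compl_mem_sigmaDef (hP : P ∈ PiDef Ap i) : Pᶜ ∈ SigmaDef Ap i := by
  obtain ⟨ψ, hψ, rfl⟩ := hP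
  exact ⟨dual ψ, hψ.dual, (lang_dual ψ).symm⟩

theorem compl_mem_sigmaDef_iff : Pᶜ ∈ SigmaDef Ap i ↔ P ∈ PiDef Ap i :=
  ⟨fun h => by rw [← compl_compl P]; exact compl_mem_piDef h, compl_mem_sigmaDef⟩

theorem PiDef.sigmaDef_succ (hP : P ∈ PiDef Ap i) : P ∈ SigmaDef Ap (i + 1) := by
  obtain ⟨ψ, hψ, rfl⟩ := hP
  exact ⟨ψ, .ofPi hψ, rfl⟩

theorem SigmaDef.deltaDef (hP : P ∈ SigmaDef Ap i) : P ∈ DeltaDef Ap i := by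
  obtain ⟨ψ, hψ, rfl⟩ := hP
  exact ⟨ψ, .ofSigma hψ, rfl⟩

theorem PiDef.deltaDef (hP : P ∈ PiDef Ap i) : P ∈ DeltaDef Ap i := by
  obtain ⟨ψ, hψ, rfl⟩ := hP
  exact ⟨ψ, .ofPi hψ, rfl⟩

theorem DeltaDef.inter (hP : P ∈ DeltaDef Ap i) (hQ : Q ∈ DeltaDef Ap i) :
    P ∩ Q ∈ DeltaDef Ap i := by
  obtain ⟨φ, hφ, rfl⟩ := hP
  obtain ⟨ψ, hψ, rfl⟩ := hQ
  exact ⟨_, hφ.and hψ, rfl⟩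

theorem DeltaDef.union (hP : P ∈ DeltaDef Ap i) (hQ : Q ∈ DeltaDef Ap i) :
    P ∪ Q ∈ DeltaDef Ap i := by
  obtain ⟨φ, hφ, rfl⟩ := hP
  obtain ⟨ψ, hψ, rfl⟩ := hQ
  exact ⟨_, hφ.or hψ, rfl⟩

theorem empty_mem_sigmaDef : ∅ ∈ SigmaDef Ap i := ⟨F.ff, .ff i, rfl⟩

theorem SigmaDef.union (hP : P ∈ SigmaDef Ap i) (hQ : Q ∈ SigmaDef Ap i) :
    P ∪ Q ∈ SigmaDef Ap i := by
  obtain ⟨φ, hφ, rfl⟩ := hP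
  obtain ⟨ψ, hψ, rfl⟩ := hQ
  exact ⟨_, hφ.or hψ, rfl⟩

theorem SigmaDef.inter (hP : P ∈ SigmaDef Ap i) (hQ : Q ∈ SigmaDef Ap i) :
    P ∩ Q ∈ SigmaDef Ap i := by
  obtain ⟨φ, hφ, rfl⟩ := hP
  obtain ⟨ψ, hψ, rfl⟩ := hQ
  exact ⟨_, hφ.and hψ, rfl⟩

theorem letter_mem_sigmaDef [Finite Ap] (a : Set Ap) :
    {w : Word Ap | w 0 = a} ∈ SigmaDef Ap i := by
  classical
  convert biInter_mem_of_finite (C := SigmaDef Ap i) ⟨F.tt, .tt i, rfl⟩ SigmaDef.inter (Set.finite_univ (α := Ap))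
    (fun p => Lang (if p ∈ a then F.pos p else F.nlit p)) fun p _ => ⟨_, ?_, rfl⟩ using 1
  · ext w
    simp only [Set.mem_iInter, Set.mem_univ, true_imp_iff, Set.mem_ofPred_eq, Set.ext_iff]
    refine forall_congr' fun p => ?_
    split_ifs with h
    · simp [h, Lang, Sat]
    · simp [h, Lang, Sat]
  · split_ifs
    · exact .pos i p
    · exact .nlit i p

/-- The transition system reading off the first letter of a word. -/
def wordStep (a : Set Ap) (w w' : Word Ap) : Prop := w 0 = a ∧ w' = suff w 1

theorem determ_wordStep : Determ (wordStep (Ap := Ap)) :=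
  fun _ _ _ _ _ h h' => ⟨h.1.symm.trans h'.1, h.2.trans h'.2.symm⟩

theorem unt_wordStep_iff {w : Word Ap} :
    Unt wordStep P Q w ↔ ∃ k, suff w k ∈ Q ∧ ∀ j < k, suff w j ∈ P := by
  constructor
  · intro h
    induction h with
    | base h => exact ⟨0, h, by simp⟩
    | @move a x y hx hs _ ih =>
      obtain ⟨-, rfl⟩ := hs
      obtain ⟨k, hk, hj⟩ := ih
      refine ⟨1 + k, by rwa [suff_suff] at hk, fun j hjk => ?_⟩
      rcases j with _ | j
      · exact hx
      · have := hj j (by omega)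
        rwa [suff_suff, add_comm] at this
  · rintro ⟨k, hk, hj⟩
    induction k generalizing w with
    | zero => exact .base hk
    | succ k ih =>
      refine .move (hj 0 k.succ_pos) ⟨rfl, rfl⟩ (ih ?_ fun j hjk => ?_)
      · rwa [suff_suff, add_comm]
      · rw [suff_suff, add_comm]
        exact hj _ (by omega)

theorem closedFamily_sigmaDef [Finite Ap] :
    ClosedFamily (wordStep (Ap := Ap)) (SigmaDef Ap (i + 1)) where
  empty := empty_mem_sigmaDef
  univ := ⟨F.tt, .tt _, rfl⟩
  union := SigmaDef.union
  inter := SigmaDef.inter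
  pred a Q hQ := by
    obtain ⟨ψ, hψ, rfl⟩ := hQ
    convert SigmaDef.inter (letter_mem_sigmaDef a) ⟨F.next ψ, .next hψ, rfl⟩ using 1
    ext w
    exact ⟨fun ⟨y, ⟨h₁, h₂⟩, h₃⟩ => ⟨h₁, by subst h₂; exact h₃⟩, fun ⟨h₁, h₂⟩ => ⟨_, ⟨h₁, rfl⟩, h₂⟩⟩
  unt := by
    rintro _ _ ⟨φ, hφ, rfl⟩ ⟨ψ, hψ, rfl⟩
    exact ⟨_, hφ.untl hψ, Set.ext fun w => unt_wordStep_iff⟩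

variable {M : Type} [Monoid M] {h : Set Ap → M}

theorem run_wordStep_iff {s : M} {w y : Word Ap} :
    Run wordStep h Set.univ s w y ↔ ∃ k, val h w k = s ∧ y = suff w k := by
  constructor
  · intro r
    induction r with
    | nil x => exact ⟨0, rfl, rfl⟩
    | cons _ hs _ ih =>
      obtain ⟨rfl, rfl⟩ := hs
      obtain ⟨k, rfl, rfl⟩ := ih
      exact ⟨k + 1, val_succ' _ _, by rw [suff_suff, add_comm]⟩
  · rintro ⟨k, rfl, rfl⟩
    induction k generalizing w with
    | zero => exact .nil w
    | succ k ih =>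
      rw [val_succ', add_comm, ← suff_suff]
      exact .cons trivial ⟨rfl, rfl⟩ ih

/-- The words with a prefix of value `s` whose remainder lies in `Q`. -/
def reach (h : Set Ap → M) (s : M) (Q : Set (Word Ap)) : Set (Word Ap) :=
  {w | ∃ k, val h w k = s ∧ suff w k ∈ Q}

/-- The words all of whose prefixes can be completed to a finite word of value `e`. -/
def completable (h : Set Ap → M) (e : M) : Set (Word Ap) :=
  {w | ∀ n, ∃ (y : Word Ap) (k : ℕ), val h w n * val h y k = e}

variable [Finite Ap] [Finite M]

theorem reach_mem_sigmaDef (hM : Aperiodic M) (s : M) (hQ : Q ∈ SigmaDef Ap (i + 1)) :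
    reach h s Q ∈ SigmaDef Ap (i + 1) := by
  convert closedFamily_sigmaDef.run_mem (Nat.card M) le_rfl hM determ_wordStep h
    (Set.finite_univ (α := Set Ap)) s hQ using 1
  ext w
  simp only [run_wordStep_iff]
  exact ⟨fun ⟨k, h₁, h₂⟩ => ⟨_, ⟨k, h₁, rfl⟩, h₂⟩, fun ⟨_, ⟨k, h₁, h₂⟩, h₃⟩ => ⟨k, h₁, h₂ ▸ h₃⟩⟩

theorem completable_mem_piDef (hM : Aperiodic M) (e : M) :
    completable h e ∈ PiDef Ap 1 := by
  rw [← compl_mem_sigmaDef_iff]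
  convert biUnion_mem_of_finite empty_mem_sigmaDef SigmaDef.union
    (Set.toFinite {m : M | ¬ ∃ (y : Word Ap) (k : ℕ), m * val h y k = e})
    (fun m => reach h m Set.univ)
    fun m _ => reach_mem_sigmaDef hM m closedFamily_sigmaDef.univ using 1
  ext w
  simp [completable, reach]

theorem infinitely_often_mem_piDef (hQ : Q ∈ SigmaDef Ap 1) :
    {w : Word Ap | ∀ N, ∃ k, suff w (N + k) ∈ Q} ∈ PiDef Ap 2 := by
  have ev : ∀ {i : ℕ} {P : Set (Word Ap)}, P ∈ SigmaDef Ap (i + 1) →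
      {w | ∃ k, suff w k ∈ P} ∈ SigmaDef Ap (i + 1) := fun {i P} hP => by
    convert closedFamily_sigmaDef.unt closedFamily_sigmaDef.univ hP using 1
    ext w
    simp [unt_wordStep_iff]
  have := ev (PiDef.sigmaDef_succ (compl_mem_piDef (ev hQ)))
  rw [← compl_mem_sigmaDef_iff]
  convert this using 1
  ext w
  simp [suff_suff]

end Definability


/-! ### Factorisations of words -/

section Factorisations

variable {Ap M : Type} [Monoid M] {h : Set Ap → M}

/-- `w` factors into a prefix of value `s` and infinitely many blocks of idempotent value `e`. -/
structure Factors (h : Set Ap → M) (w : Word Ap) (s e : M) : Prop where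
  idem : e * e = e
  absorb : s * e = s
  cuts : ∃ k : ℕ → ℕ, StrictMono k ∧ val h w (k 0) = s ∧
    ∀ i, val h (suff w (k i)) (k (i + 1) - k i) = e

theorem val_blocks {e : M} (he : e * e = e) {w : Word Ap} {k : ℕ → ℕ} (hk : StrictMono k)
    (hseg : ∀ i, val h (suff w (k i)) (k (i + 1) - k i) = e) (i d : ℕ) :
    val h (suff w (k i)) (k (i + (d + 1)) - k i) = e := by
  induction d with
  | zero => exact hseg i
  | succ d ih =>
    have h₁ : k i < k (i + (d + 1)) := hk (by omega)
    have h₂ : k (i + (d + 1)) < k (i + (d + 1) + 1) := hk (by omega)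
    rw [val_of_le (suff w (k i)) (show k (i + (d + 1)) - k i ≤ k (i + (d + 1 + 1)) - k i from
      Nat.sub_le_sub_right h₂.le _), ih, suff_suff, Nat.add_sub_cancel' h₁.le,
      show k (i + (d + 1 + 1)) - k i - (k (i + (d + 1)) - k i) =
        k (i + (d + 1) + 1) - k (i + (d + 1)) by rw [← add_assoc i (d + 1)]; omega, hseg, he]

theorem exists_factors [Finite M] (h : Set Ap → M) (w : Word Ap) : ∃ s e, Factors h w s e := by
  let U := Filter.hyperfilter ℕ
  have const : ∀ g : ℕ → M, ∃ e, ∀ᶠ j in U, g j = e := fun g =>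
    Ultrafilter.eventually_exists_iff.1 (Filter.Eventually.of_forall fun j => ⟨g j, rfl⟩)
  have large : ∀ n : ℕ, ∀ᶠ j in U, n < j := fun n =>
    Filter.Eventually.filter_mono Nat.hyperfilter_le_atTop (Filter.eventually_gt_atTop n)
  choose c hc using fun i => const fun j => val h (suff w i) (j - i)
  obtain ⟨e, he⟩ := const c
  have next : ∀ i, c i = e → ∃ j, i < j ∧ c j = e ∧ val h (suff w i) (j - i) = e := fun i hi =>
    ((large i).and (he.and (hc i))).exists.imp fun j hj => ⟨hj.1, hj.2.1, hj.2.2.trans hi⟩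
  have idem : e * e = e := by
    obtain ⟨i, hi⟩ := he.exists
    obtain ⟨j, hij, hj, hv⟩ := next i hi
    obtain ⟨l, hjl, hl₁, hl₂⟩ := ((large j).and ((hc i).and (hc j))).exists
    rw [hi, val_of_le _ (show j - i ≤ l - i by omega), hv, suff_suff,
      show i + (j - i) = j by omega, show l - i - (j - i) = l - j by omega, hl₂, hj] at hl₁
    exact hl₁
  choose! f hf₁ hf₂ hf₃ using next
  obtain ⟨a, ha⟩ := he.exists
  have hA : ∀ n, c (f^[n] a) = e := fun n => by
    induction n with
    | zero => exact ha
    | succ n ih => rw [Function.iterate_succ_apply']; exact hf₂ _ ih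
  have hlt : ∀ n, f^[n] a < f^[n + 1] a := fun n => by
    rw [Function.iterate_succ_apply']; exact hf₁ _ (hA n)
  have hseg : ∀ n, val h (suff w (f^[n] a)) (f^[n + 1] a - f^[n] a) = e := fun n => by
    rw [Function.iterate_succ_apply']; exact hf₃ _ (hA n)
  refine ⟨val h w (f^[1] a), e, idem, ?_, fun n => f^[n + 1] a,
    strictMono_nat_of_lt_succ fun n => hlt _, rfl, fun n => hseg _⟩
  rw [val_of_le w (hlt 0).le, hseg 0, mul_assoc, idem]

theorem Factors.splice {x v : Word Ap} {n : ℕ} {s e : M} (hv : Factors h v s e) :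
    Factors h (splice x n v) (val h x n * s) e := by
  obtain ⟨k, hk, h0, hseg⟩ := hv.cuts
  refine ⟨hv.idem, by rw [mul_assoc, hv.absorb], fun i => n + k i,
    fun i j hij => Nat.add_lt_add_left (hk hij) n, ?_, fun i => ?_⟩
  · rw [val_splice_add, h0]
  · rw [suff_splice_add, Nat.add_sub_add_left, hseg]

theorem Factors.mem_reach {w : Word Ap} {s e : M} (hw : Factors h w s e) :
    w ∈ reach h s (completable h e) := by
  obtain ⟨k, hk, h0, hseg⟩ := hw.cuts
  refine ⟨k 0, h0, fun n => ⟨suff (suff w (k 0)) n, k (0 + (n + 1)) - k 0 - n, ?_⟩⟩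
  have : n + 1 + k 0 ≤ k (0 + (n + 1)) := by
    rw [zero_add]
    exact hk.add_le_nat (n + 1) 0
  rw [← val_of_le _ (by omega), val_blocks hw.idem hk hseg]

theorem Factors.mem_reach_inter {w : Word Ap} {s e : M} (hw : Factors h w s e) :
    w ∈ reach h s Set.univ ∩ completable h s := by
  obtain ⟨k, hk, h0, hseg⟩ := hw.cuts
  refine ⟨⟨k 0, h0, trivial⟩, fun n => ⟨suff w n, k (0 + (n + 1)) - n, ?_⟩⟩
  have : n + 1 + k 0 ≤ k (0 + (n + 1)) := by
    rw [zero_add]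
    exact hk.add_le_nat (n + 1) 0
  rw [← val_of_le w (by omega), val_of_le w (show k 0 ≤ k (0 + (n + 1)) by omega),
    val_blocks hw.idem hk hseg, h0, hw.absorb]

theorem Factors.exists_factor {w : Word Ap} {s e m : M} (hw : Factors h w s e)
    (hm : ∀ N, ∃ k, suff w (N + k) ∈ reach h m Set.univ) : ∃ x y, e = x * m * y := by
  obtain ⟨k, hk, h0, hseg⟩ := hw.cuts
  obtain ⟨d, n, rfl, -⟩ := hm (k 0)
  have : d + n + 1 + k 0 ≤ k (0 + (d + n + 1)) := by
    rw [zero_add]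
    exact hk.add_le_nat (d + n + 1) 0
  refine ⟨val h (suff w (k 0)) d,
    val h (suff (suff w (k 0)) (d + n)) (k (0 + (d + n + 1)) - k 0 - (d + n)), ?_⟩
  rw [← suff_suff, ← val_add, ← val_of_le _ (by omega), val_blocks hw.idem hk hseg]

theorem Factors.infinitely_often {w : Word Ap} {s e : M} (hw : Factors h w s e) (N : ℕ) :
    ∃ k, suff w (N + k) ∈ reach h e Set.univ := by
  obtain ⟨k, hk, h0, hseg⟩ := hw.cuts
  have := hk.le_apply (x := N)
  exact ⟨k N - N, k (N + 1) - k N, by rw [Nat.add_sub_cancel' this, hseg], trivial⟩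

variable {P : Set (Word Ap)}

theorem Recognizes.compl (hP : Recognizes h P) : Recognizes h Pᶜ :=
  fun w w' k k' hk hk' h0 hseg => not_congr (hP w w' k k' hk hk' h0 hseg)

theorem Recognizes.mem_iff (hP : Recognizes h P) {w w' : Word Ap} {s e : M}
    (hw : Factors h w s e) (hw' : Factors h w' s e) : w ∈ P ↔ w' ∈ P := by
  obtain ⟨k, hk, h0, hseg⟩ := hw.cuts
  obtain ⟨k', hk', h0', hseg'⟩ := hw'.cuts
  exact hP w w' k k' hk hk' (h0.trans h0'.symm) fun i => (hseg i).trans (hseg' i).symm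

theorem Recognizes.splice_mem_iff [Finite M] (hP : Recognizes h P) {x x' v : Word Ap} {n n' : ℕ}
    (hx : val h x n = val h x' n') : splice x n v ∈ P ↔ splice x' n' v ∈ P := by
  obtain ⟨s, e, hv⟩ := exists_factors h v
  refine hP.mem_iff (hv.splice (x := x) (n := n)) ?_
  rw [hx]
  exact hv.splice

theorem exists_periodic (y : Word Ap) (p : ℕ) :
    ∃ z : Word Ap, (∀ j < p, z j = y j) ∧ ∀ i c, suff z (i * p + c) = suff z c :=
  ⟨fun j => y (j % p), fun j hj => by simp [Nat.mod_eq_of_lt hj], fun i c => funext fun j => by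
    simp only [suff]
    rw [add_left_comm, add_comm, Nat.add_mul_mod_self_right]⟩

/-- The key algebraic fact behind the `Δ₂` normal form. -/
theorem eq_of_aperiodic (hM : Aperiodic M) {e f r t a b : M} (he : e * e = e)
    (hr : r * f = r) (ht : r * t = e) (hab : f = a * e * b) :
    f * t * r = f ∧ r * f * t = e := by
  have hfg : f = a * r * f * (t * b) := by
    conv_lhs => rw [hab, ← ht, ← hr]
    simp only [mul_assoc]
  have hpow : ∀ n : ℕ, f = (a * r) ^ n * f * (t * b) ^ n := fun n => by
    induction n with
    | zero => simp
    | succ n ih =>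
      conv_lhs => rw [ih, hfg]
      rw [pow_succ, pow_succ']
      simp only [mul_assoc]
  have hfg' : f * (t * b) = f := by
    obtain ⟨n, hn⟩ := hM (t * b)
    conv_lhs => rw [hpow n, mul_assoc _ _ (t * b), ← pow_succ, hn]
    exact (hpow n).symm
  have har : f = a * r := by
    conv_lhs => rw [hfg, mul_assoc, hfg', mul_assoc, hr]
  have hrb : e * b = r := by
    rw [← ht, mul_assoc, ← hr, mul_assoc, hfg']
  have her : e * r = r := by rw [← hrb, ← mul_assoc, he]
  refine ⟨?_, by rw [hr, ht]⟩
  rw [har, mul_assoc a, ht, mul_assoc, her]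

/-- A word whose tail is completable to `e`, and in which `e` occurs infinitely often, is equivalent
to a word with factorisation `(s, e)`. -/
theorem Recognizes.mem_of_reach [Finite M] (hM : Aperiodic M) (hP : Recognizes h P)
    {w w' : Word Ap} {s e : M} (hw : w ∈ P) (hF : Factors h w s e)
    (hw' : w' ∈ reach h s (completable h e))
    (hinf : ∀ N, ∃ k, suff w' (N + k) ∈ reach h e Set.univ) : w' ∈ P := by
  obtain ⟨n, hn, hv⟩ := hw'
  obtain ⟨r, f, hvF⟩ := exists_factors h (suff w' n)
  have hw'F := hvF.splice (x := w') (n := n)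
  rw [splice_suff, hn] at hw'F
  obtain ⟨a, b, hab⟩ := hw'F.exists_factor hinf
  obtain ⟨k, hk, h0, hseg⟩ := hvF.cuts
  obtain ⟨y, l, hy⟩ := hv (k 0)
  rw [h0] at hy
  set t := val h y l
  obtain ⟨h₁, h₂⟩ := eq_of_aperiodic hM hF.idem hvF.absorb hy hab
  have hk01 : k 0 < k 1 := hk one_pos
  have hp : 0 < k 1 + l := by omega
  obtain ⟨Z, hZ, hper⟩ := exists_periodic (splice (suff w' n) (k 1) y) (k 1 + l)
  have hZr : val h Z (k 0) = r := by
    rw [← h0]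
    exact val_congr fun j hj => by rw [hZ j (by omega), splice_of_lt _ _ (hj.trans hk01)]
  have hZe : val h Z (k 1 + l) = e := by
    rw [val_congr hZ, val_splice_add, val_of_le _ hk01.le, h0, hseg 0, h₂]
  have hZ1 : suff Z (k 1 + l) = Z := by
    have := hper 1 0
    rwa [one_mul, add_zero] at this
  have hZf : val h (suff Z (k 0)) (k 1 + l) = f := by
    have hft : val h (suff Z (k 0)) (k 1 + l - k 0) = f * t := by
      rw [show k 1 + l - k 0 = k 1 - k 0 + l by omega, val_add, suff_suff,
        Nat.add_sub_cancel' hk01.le, ← hseg 0]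
      congr 1
      · refine val_congr fun j hj => ?_
        have hj' : j + k 0 < k 1 := by omega
        rw [suff_apply, hZ _ (by omega), splice_of_lt _ _ hj', ← suff_apply (suff w' n)]
      · refine val_congr fun j hj => ?_
        rw [suff_apply, hZ _ (by omega), ← suff_apply (splice _ _ _), suff_splice]
    rw [val_of_le _ (show k 1 + l - k 0 ≤ k 1 + l by omega), hft, suff_suff,
      show k 0 + (k 1 + l - k 0) = k 1 + l by omega, hZ1,
      show k 1 + l - (k 1 + l - k 0) = k 0 by omega, hZr, h₁]
  have mono : ∀ c, StrictMono fun i => i * (k 1 + l) + c := fun c => strictMono_nat_of_lt_succ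
    fun i => by rw [Nat.add_one_mul]; omega
  have diff : ∀ i c, (i + 1) * (k 1 + l) + c - (i * (k 1 + l) + c) = k 1 + l := fun i c => by
    rw [Nat.add_one_mul]; omega
  have hZe' : Factors h Z e e := by
    refine ⟨hF.idem, hF.idem, _, mono (k 1 + l), by rwa [zero_mul, zero_add], fun i => ?_⟩
    rw [hper, diff, hZ1, hZe]
  have hZf' : Factors h Z r f := by
    refine ⟨hvF.idem, hvF.absorb, _, mono (k 0), by rwa [zero_mul, zero_add], fun i => ?_⟩
    rw [hper, diff, hZf]
  have h₃ := hZe'.splice (x := w') (n := n)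
  have h₄ := hZf'.splice (x := w') (n := n)
  rw [hn] at h₃ h₄
  rw [hF.absorb] at h₃
  exact (hP.mem_iff hw'F h₄).2 ((hP.mem_iff hF h₃).1 hw)

end Factorisations


/-! ### Limits of nested prefixes -/

section Limits

variable {Ap M : Type} [Monoid M] {h : Set Ap → M} {P Q : Set (Word Ap)}

theorem exists_limit {Inv : Word Ap × ℕ → Prop} {R : Word Ap × ℕ → Word Ap × ℕ → Prop}
    (step : ∀ c, Inv c → ∃ c', Inv c' ∧ c.2 < c'.2 ∧ (∀ j < c.2, c'.1 j = c.1 j) ∧ R c c')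
    {c₀ : Word Ap × ℕ} (h₀ : Inv c₀) :
    ∃ (w : Word Ap) (c : ℕ → Word Ap × ℕ), StrictMono (fun i => (c i).2) ∧ (∀ i, Inv (c i)) ∧
      (∀ i, R (c i) (c (i + 1))) ∧ ∀ i, ∀ j < (c i).2, w j = (c i).1 j := by
  choose! f hf₁ hf₂ hf₃ hf₄ using step
  have hInv : ∀ i, Inv (f^[i] c₀) := fun i => by
    induction i with
    | zero => exact h₀
    | succ i ih => rw [Function.iterate_succ_apply']; exact hf₁ _ ih
  have hmono : StrictMono fun i => (f^[i] c₀).2 := strictMono_nat_of_lt_succ fun i => by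
    rw [Function.iterate_succ_apply']
    exact hf₂ _ (hInv i)
  have hagree : ∀ i d, ∀ j < (f^[i] c₀).2, (f^[i + d] c₀).1 j = (f^[i] c₀).1 j := fun i d => by
    induction d with
    | zero => exact fun _ _ => rfl
    | succ d ih =>
      intro j hj
      rw [← ih j hj, ← add_assoc, Function.iterate_succ_apply']
      exact hf₃ _ (hInv _) j (hj.trans_le (hmono.monotone (Nat.le_add_right i d)))
  refine ⟨fun j => (f^[j + 1] c₀).1 j, fun i => f^[i] c₀, hmono, hInv, fun i => ?_,
    fun i j hj => ?_⟩
  · beta_reduce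
    rw [Function.iterate_succ_apply']
    exact hf₄ _ (hInv i)
  · rcases le_total i (j + 1) with hij | hij
    · obtain ⟨d, hd⟩ := Nat.exists_eq_add_of_le hij
      beta_reduce
      rw [hd]
      exact hagree i d j hj
    · obtain ⟨d, rfl⟩ := Nat.exists_eq_add_of_le hij
      exact (hagree (j + 1) d j (hmono.le_apply (x := j + 1))).symm

theorem exists_hit {L : Set (List (Set Ap))} {x v : Word Ap} {n : ℕ} {s : M} {p : M → Prop}
    (hp : ∀ m, p m → s * m = s) (hv : ∀ d, ∃ (y : Word Ap) (k : ℕ), p (val h v d * val h y k))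
    (hL : {m | pre (splice x n v) m ∈ L}.Infinite) (hx : val h x n = s) :
    ∃ (x' : Word Ap) (n' : ℕ), n < n' ∧ (∀ j < n, x' j = x j) ∧ val h x' n' = s ∧
      p (val h (suff x' n) (n' - n)) ∧ ∃ m, n ≤ m ∧ m < n' ∧ pre x' m ∈ L := by
  obtain ⟨m, hm, hnm⟩ := hL.exists_gt n
  obtain ⟨d, rfl⟩ := Nat.exists_eq_add_of_lt hnm
  obtain ⟨y, k, hyk⟩ := hv (d + 2)
  have hseg : val h (suff (splice x n (splice v (d + 2) y)) n) (n + (d + 2 + k) - n) =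
      val h v (d + 2) * val h y k := by
    rw [suff_splice, Nat.add_sub_cancel_left, val_splice_add]
  refine ⟨splice x n (splice v (d + 2) y), n + (d + 2 + k), by omega,
    fun j hj => splice_of_lt _ _ hj, ?_, by rwa [hseg], n + d + 1, by omega, by omega, ?_⟩
  · rw [val_splice_add, val_splice_add, hx, hp _ hyk]
  · rw [pre_eq_pre_iff.2]
    · exact hm
    · intro j hj
      by_cases hjn : j < n
      · rw [splice_of_lt _ _ hjn, splice_of_lt _ _ hjn]
      · simp only [splice, if_neg hjn, if_pos (show j - n < d + 2 by omega)]

theorem infinite_hits {L : Set (List (Set Ap))} {w : Word Ap} {c : ℕ → Word Ap × ℕ}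
    (hc : StrictMono fun i => (c i).2) (hw : ∀ i, ∀ j < (c i).2, w j = (c i).1 j)
    (hL : ∀ i, ∃ m, (c i).2 ≤ m ∧ m < (c (i + 1)).2 ∧ pre (c (i + 1)).1 m ∈ L) :
    {m | pre w m ∈ L}.Infinite := by
  refine Set.infinite_of_forall_exists_gt fun a => ?_
  obtain ⟨m, hm₁, hm₂, hm₃⟩ := hL (a + 1)
  refine ⟨m, ?_, (hc.le_apply (x := a + 1)).trans hm₁⟩
  rwa [Set.mem_ofPred_eq, pre_eq_pre_iff.2 fun j hj => hw (a + 1 + 1) j (hj.trans hm₂)]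

variable [Finite M]

theorem Recognizes.mem_of_persistenceP (hP : Recognizes h P) (hPP : PersistenceP P)
    {w w' : Word Ap} {s e : M} (hw : w ∈ P) (hF : Factors h w s e)
    (hw' : w' ∈ reach h s (completable h e)) : w' ∈ P := by
  by_contra hnot
  rw [← compl_compl P, persistenceP_compl_iff] at hPP
  obtain ⟨L, hL⟩ := hPP
  obtain ⟨n, hn, hv⟩ := hw'
  obtain ⟨W, c, hmono, hInv, hR, hW⟩ := exists_limit
    (Inv := fun c => val h c.1 c.2 = s)
    (R := fun c c' => val h (suff c'.1 c.2) (c'.2 - c.2) = e ∧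
      ∃ m, c.2 ≤ m ∧ m < c'.2 ∧ pre c'.1 m ∈ L)
    (fun c hc => by
      have hmem : splice c.1 c.2 (suff w' n) ∈ Pᶜ := by
        rw [hP.compl.splice_mem_iff (hc.trans hn.symm), splice_suff]
        exact hnot
      obtain ⟨x', n', h₁, h₂, h₃, h₄⟩ := exists_hit (p := fun m => m = e)
        (fun m hm => by rw [hm, hF.absorb]) hv ((hL _).1 hmem) hc
      exact ⟨(x', n'), h₃, h₁, h₂, h₄⟩) (c₀ := (w', n)) hn
  have hWF : Factors h W s e := by
    refine ⟨hF.idem, hF.absorb, _, hmono, (val_congr (hW 0)).trans (hInv 0), fun i => ?_⟩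
    have hlt : (c i).2 < (c (i + 1)).2 := hmono i.lt_succ_self
    rw [← (hR i).1]
    exact val_congr fun j hj => hW (i + 1) _ (by omega)
  exact (hL W).2 (infinite_hits hmono hW fun i => (hR i).2) ((hP.mem_iff hF hWF).1 hw)

theorem Recognizes.mem_of_recurrenceP (hP : Recognizes h P) (h₁ : RecurrenceP P)
    (h₂ : RecurrenceP Pᶜ) {w w' : Word Ap} {s : M} (hw : w ∈ P)
    (hws : w ∈ reach h s Set.univ ∩ completable h s)
    (hws' : w' ∈ reach h s Set.univ ∩ completable h s) : w' ∈ P := by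
  by_contra hnot
  obtain ⟨L, hL⟩ := h₁
  obtain ⟨L', hL'⟩ := h₂
  obtain ⟨⟨n, hn, -⟩, hc⟩ := hws
  obtain ⟨⟨n', hn', -⟩, hc'⟩ := hws'
  have tail : ∀ {w : Word Ap} {n : ℕ}, val h w n = s → w ∈ completable h s →
      ∀ d, ∃ (y : Word Ap) (k : ℕ), s * (val h (suff w n) d * val h y k) = s :=
    fun {w n} hn hc d => by
      obtain ⟨y, k, hyk⟩ := hc (n + d)
      exact ⟨y, k, by rwa [val_add, hn, mul_assoc] at hyk⟩
  obtain ⟨W, c, hmono, hInv, hR, hW⟩ := exists_limit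
    (Inv := fun c => val h c.1 c.2 = s)
    (R := fun c c' => (∃ m, c.2 ≤ m ∧ m < c'.2 ∧ pre c'.1 m ∈ L) ∧
      ∃ m, c.2 ≤ m ∧ m < c'.2 ∧ pre c'.1 m ∈ L')
    (fun c hInv => by
      have hmem : splice c.1 c.2 (suff w n) ∈ P := by
        rw [hP.splice_mem_iff (hInv.trans hn.symm), splice_suff]
        exact hw
      obtain ⟨x₁, n₁, hlt₁, hag₁, hval₁, -, m₁, hm₁, hm₁', hpre₁⟩ :=
        exists_hit (p := fun m => s * m = s) (fun _ => id) (tail hn hc) ((hL _).1 hmem) hInv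
      have hmem' : splice x₁ n₁ (suff w' n') ∈ Pᶜ := by
        rw [hP.compl.splice_mem_iff (hval₁.trans hn'.symm), splice_suff]
        exact hnot
      obtain ⟨x₂, n₂, hlt₂, hag₂, hval₂, -, m₂, hm₂, hm₂', hpre₂⟩ :=
        exists_hit (p := fun m => s * m = s) (fun _ => id) (tail hn' hc') ((hL' _).1 hmem') hval₁
      refine ⟨(x₂, n₂), hval₂, hlt₁.trans hlt₂,
        fun j hj => (hag₂ j (hj.trans hlt₁)).trans (hag₁ j hj),
        ⟨m₁, hm₁, hm₁'.trans hlt₂, ?_⟩, m₂, hlt₁.le.trans hm₂, hm₂', hpre₂⟩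
      rwa [pre_eq_pre_iff.2 fun j hj => hag₂ j (hj.trans hm₁')]) (c₀ := (w, n)) hn
  exact (hL' W).2 (infinite_hits hmono hW fun i => (hR i).2)
    ((hL W).2 (infinite_hits hmono hW fun i => (hR i).1))

end Limits

/-! ### Normal forms -/

section NormalForms

variable {Ap M : Type} [Monoid M] [Finite Ap] [Finite M] {h : Set Ap → M} {P : Set (Word Ap)}

theorem Recognizes.mem_sigmaDef_one (hM : Aperiodic M) (hP : Recognizes h P)
    (hG : GuaranteeP P) : P ∈ SigmaDef Ap 1 := by
  rw [guaranteeP_iff] at hG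
  convert biUnion_mem_of_finite empty_mem_sigmaDef SigmaDef.union
    (Set.toFinite {s : M | ∃ (x : Word Ap) (n : ℕ), val h x n = s ∧ ∀ v, splice x n v ∈ P})
    (fun s => reach h s Set.univ)
    fun s _ => reach_mem_sigmaDef hM s closedFamily_sigmaDef.univ using 1
  ext w
  simp only [Set.mem_iUnion, exists_prop]
  constructor
  · intro hw
    obtain ⟨n, hn⟩ := hG w hw
    exact ⟨_, ⟨w, n, rfl, fun v => hn _ fun j hj => splice_of_lt _ _ hj⟩, n, rfl, trivial⟩
  · rintro ⟨s, ⟨x, n, hx, hv⟩, k, hk, -⟩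
    rw [← splice_suff w k, hP.splice_mem_iff (hk.trans hx.symm)]
    exact hv _

theorem Recognizes.mem_sigmaDef_two (hM : Aperiodic M) (hP : Recognizes h P)
    (hPP : PersistenceP P) : P ∈ SigmaDef Ap 2 := by
  convert biUnion_mem_of_finite empty_mem_sigmaDef SigmaDef.union
    (Set.toFinite {q : M × M | ∃ w ∈ P, Factors h w q.1 q.2})
    (fun q => reach h q.1 (completable h q.2))
    fun q _ => reach_mem_sigmaDef hM q.1 (PiDef.sigmaDef_succ (completable_mem_piDef hM q.2)) using 1
  ext w
  simp only [Set.mem_iUnion, exists_prop]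
  constructor
  · intro hw
    obtain ⟨s, e, hF⟩ := exists_factors h w
    exact ⟨(s, e), ⟨w, hw, hF⟩, hF.mem_reach⟩
  · rintro ⟨q, ⟨w', hw', hF⟩, hw⟩
    exact hP.mem_of_persistenceP hPP hw' hF hw

theorem Recognizes.mem_deltaDef_one (hM : Aperiodic M) (hP : Recognizes h P)
    (hO : ObligationP P) : P ∈ DeltaDef Ap 1 := by
  have h₁ : RecurrenceP P := persistenceP_compl_iff.1 hO.persistenceP.2
  have h₂ : RecurrenceP Pᶜ := persistenceP_compl_iff.1 (by
    rw [compl_compl]; exact hO.persistenceP.1)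
  convert biUnion_mem_of_finite (SigmaDef.deltaDef empty_mem_sigmaDef) DeltaDef.union
    (Set.toFinite {s : M | ∃ w ∈ P, w ∈ reach h s Set.univ ∩ completable h s})
    (fun s => reach h s Set.univ ∩ completable h s)
    fun s _ => DeltaDef.inter
      (SigmaDef.deltaDef (reach_mem_sigmaDef hM s closedFamily_sigmaDef.univ))
      (PiDef.deltaDef (completable_mem_piDef hM s)) using 1
  ext w
  simp only [Set.mem_iUnion, exists_prop]
  constructor
  · intro hw
    obtain ⟨s, e, hF⟩ := exists_factors h w
    have : w ∈ reach h s Set.univ ∩ completable h s := hF.mem_reach_inter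
    exact ⟨s, ⟨w, hw, this⟩, this⟩
  · rintro ⟨s, ⟨w', hw', hs⟩, hw⟩
    exact hP.mem_of_recurrenceP h₁ h₂ hw' hs hw

theorem Recognizes.mem_deltaDef_two (hM : Aperiodic M) (hP : Recognizes h P) :
    P ∈ DeltaDef Ap 2 := by
  convert biUnion_mem_of_finite (SigmaDef.deltaDef empty_mem_sigmaDef) DeltaDef.union
    (Set.toFinite {q : M × M | ∃ w ∈ P, Factors h w q.1 q.2})
    (fun q => reach h q.1 (completable h q.2) ∩
      {w | ∀ N, ∃ k, suff w (N + k) ∈ reach h q.2 Set.univ})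
    fun q _ => DeltaDef.inter
      (SigmaDef.deltaDef (reach_mem_sigmaDef hM q.1
        (PiDef.sigmaDef_succ (completable_mem_piDef hM q.2))))
      (PiDef.deltaDef (infinitely_often_mem_piDef
        (reach_mem_sigmaDef hM q.2 closedFamily_sigmaDef.univ))) using 1
  ext w
  simp only [Set.mem_iUnion, exists_prop]
  constructor
  · intro hw
    obtain ⟨s, e, hF⟩ := exists_factors h w
    exact ⟨(s, e), ⟨w, hw, hF⟩, hF.mem_reach, hF.infinitely_often⟩
  · rintro ⟨q, ⟨w', hw', hF⟩, hw, hinf⟩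
    exact hP.mem_of_reach hM hw' hF hw hinf

end NormalForms


/-- For properties expressible in LTL, the semantic
safety-progress classes coincide with the syntactic future hierarchy. -/
theorem hierarchy_correspondence {Ap : Type} [Fintype Ap] (P : Set (Word Ap))
    (hP : ∃ φ : F Ap, P = Lang φ) :
    (GuaranteeP P ↔ ∃ ψ : F Ap, SigmaC Ap 1 ψ ∧ P = Lang ψ) ∧
    (SafetyP P ↔ ∃ ψ : F Ap, PiC Ap 1 ψ ∧ P = Lang ψ) ∧
    (ObligationP P ↔ ∃ ψ : F Ap, DeltaC Ap 1 ψ ∧ P = Lang ψ) ∧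
    (PersistenceP P ↔ ∃ ψ : F Ap, SigmaC Ap 2 ψ ∧ P = Lang ψ) ∧
    (RecurrenceP P ↔ ∃ ψ : F Ap, PiC Ap 2 ψ ∧ P = Lang ψ) ∧
    (ReactivityP P ↔ ∃ ψ : F Ap, DeltaC Ap 2 ψ ∧ P = Lang ψ) := by
  obtain ⟨φ, rfl⟩ := hP
  obtain ⟨M, _, _, h, hM, hR⟩ := exists_recognizes φ
  refine ⟨⟨hR.mem_sigmaDef_one hM, ?_⟩,
    ⟨fun hS => compl_mem_sigmaDef_iff.1 (hR.compl.mem_sigmaDef_one hM (guaranteeP_compl_iff.2 hS)),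
      ?_⟩,
    ⟨hR.mem_deltaDef_one hM, ?_⟩, ⟨hR.mem_sigmaDef_two hM, ?_⟩,
    ⟨fun hS => compl_mem_sigmaDef_iff.1
      (hR.compl.mem_sigmaDef_two hM (persistenceP_compl_iff.2 hS)), ?_⟩,
    ⟨fun _ => hR.mem_deltaDef_two hM, ?_⟩⟩ <;>
    rintro ⟨ψ, hψ, h⟩ <;> rw [h]
  · exact guaranteeP_iff.2 hψ.lang_mem
  · exact guaranteeP_compl_iff.1 (guaranteeP_iff.2 hψ.lang_compl_mem)
  · exact hψ.obligationP
  · exact persistenceP_iff.2 hψ.lang_mem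
  · exact persistenceP_compl_iff.1 (persistenceP_iff.2 hψ.lang_compl_mem)
  · exact hψ.reactivityP

end LTLNorm
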